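/- For every integer h ≥ 2 there exists a function Λ(m,n,d,h), independent of N and of K, with the following property: for every algebraically closed field K, every N, and all submodules M_1,…,M_h of R^m over R = K[x_1,…,x_N], each of which has a generating set bounded by (n,d), the intersection M_1 ∩ … ∩ M_h has a generating set bounded by (Λ(m,n,d,h), Λ(m,n,d,h)). -/

import Mathlib

universe u v

section

namespace MvPolynomial

theorem totalDegree_aeval_le {R σ τ : Type*} [CommSemiring R] (f : MvPolynomial σ R)
    (v : σ → MvPolynomial τ R) {e : ℕ} (hv : ∀ i, (v i).totalDegree ≤ e) :
    (aeval v f).totalDegree ≤ f.totalDegree * e := by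
  rw [aeval_def, eval₂_eq]
  refine totalDegree_finsetSum_le fun s hs => ?_
  refine (totalDegree_mul _ _).trans ?_
  rw [algebraMap_eq, totalDegree_C, zero_add]
  refine (totalDegree_finsetProd _ _).trans ?_
  refine (Finset.sum_le_sum fun i _ => (totalDegree_pow _ _).trans
    (Nat.mul_le_mul_left _ (hv i))).trans ?_
  rw [← Finset.sum_mul]
  exact Nat.mul_le_mul_right _ (le_totalDegree hs)

theorem totalDegree_aeval_le_of_le_one {R σ τ : Type*} [CommSemiring R] (f : MvPolynomial σ R)
    (v : σ → MvPolynomial τ R) (hv : ∀ i, (v i).totalDegree ≤ 1) :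
    (aeval v f).totalDegree ≤ f.totalDegree := by
  simpa using totalDegree_aeval_le f v hv

/-- The linear change of variables fixing `X l₀` and sending `X l` to `X l + p l X l₀`. -/
noncomputable def shearHom {K σ : Type*} [CommRing K] [DecidableEq σ] (l₀ : σ) (p : σ → K) :
    MvPolynomial σ K →ₐ[K] MvPolynomial σ K :=
  aeval fun l => if l = l₀ then X l₀ else X l + C (p l) * X l₀

theorem shearHom_comp {K σ : Type*} [CommRing K] [DecidableEq σ] (l₀ : σ) (p q : σ → K)
    (h : ∀ l, p l + q l = 0) :
    (shearHom l₀ p).comp (shearHom l₀ q) = AlgHom.id K _ := by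
  refine algHom_ext fun l => ?_
  by_cases hl : l = l₀
  · simp [shearHom, hl]
  · have : (C (p l) : MvPolynomial σ K) + C (q l) = 0 := by rw [← C_add, h, C_0]
    simp [shearHom, hl]
    linear_combination this * X l₀

noncomputable def shear {K σ : Type*} [CommRing K] [DecidableEq σ] (l₀ : σ) (p : σ → K) :
    MvPolynomial σ K ≃ₐ[K] MvPolynomial σ K :=
  AlgEquiv.ofAlgHom (shearHom l₀ p) (shearHom l₀ (-p))
    (shearHom_comp _ _ _ fun l => by simp) (shearHom_comp _ _ _ fun l => by simp)

theorem totalDegree_shearHom_le {K σ : Type*} [CommRing K] [DecidableEq σ] (l₀ : σ) (p : σ → K)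
    (f : MvPolynomial σ K) : (shearHom l₀ p f).totalDegree ≤ f.totalDegree := by
  cases subsingleton_or_nontrivial K
  · simp [Subsingleton.elim (shearHom l₀ p f) 0]
  refine totalDegree_aeval_le_of_le_one _ _ fun l => ?_
  split_ifs
  · simp
  · refine (totalDegree_add _ _).trans (max_le (by simp) ((totalDegree_mul _ _).trans (by simp)))

theorem exists_eval_ne_zero_of_isHomogeneous {K σ : Type*} [Field K] [Infinite K]
    {h : MvPolynomial σ K} {s : ℕ} (hh : h.IsHomogeneous s) (h0 : h ≠ 0) (l₀ : σ) :
    ∃ p : σ → K, p l₀ = 1 ∧ eval p h ≠ 0 := by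
  have h1 : h * X l₀ ≠ 0 := mul_ne_zero h0 (X_ne_zero _)
  obtain ⟨p, hp⟩ : ∃ p : σ → K, eval p (h * X l₀) ≠ 0 := by
    by_contra! hc
    exact h1 (MvPolynomial.funext fun p => by simpa using hc p)
  rw [map_mul, eval_X] at hp
  have hp0 : p l₀ ≠ 0 := right_ne_zero_of_mul hp
  refine ⟨(p l₀)⁻¹ • p, by simp [hp0], ?_⟩
  rw [eval_eq, Finset.sum_congr rfl
      (g := fun d => (p l₀)⁻¹ ^ s * (coeff d h * ∏ i ∈ d.support, p i ^ d i)),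
    ← Finset.mul_sum, ← eval_eq]
  · exact mul_ne_zero (pow_ne_zero _ (inv_ne_zero hp0)) (left_ne_zero_of_mul hp)
  · intro d hd
    have := hh (mem_support_iff.mp hd)
    simp only [Pi.smul_apply, smul_eq_mul, mul_pow, Finset.prod_mul_distrib,
      Finset.prod_pow_eq_pow_sum]
    have h2 : ∑ i ∈ d.support, d i = s := by
      rw [← this, Finsupp.weight_apply, Finsupp.sum]; simp
    rw [h2]; ring

end MvPolynomial

open MvPolynomial

/-- The solutions of the linear system `C` form a module generated by `B` vectors with entries of
total degree at most `B`. -/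
def KerBound {K σ ι κ : Type*} [CommRing K] [Fintype ι] (C : κ → ι → MvPolynomial σ K)
    (B : ℕ) : Prop :=
  ∃ g : Fin B → ι → MvPolynomial σ K, (∀ a j, (g a j).totalDegree ≤ B) ∧
    (∀ a k, ∑ j, C k j * g a j = 0) ∧
    ∀ s : ι → MvPolynomial σ K, (∀ k, ∑ j, C k j * s j = 0) →
      ∃ c : Fin B → MvPolynomial σ K, ∀ j, s j = ∑ a, c a * g a j

namespace KerBound

variable {K σ ι κ : Type*} [CommRing K] [Fintype ι] {C : κ → ι → MvPolynomial σ K}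

theorem of_family {α : Type*} [Fintype α] {B : ℕ} (hB : Fintype.card α ≤ B)
    (g : α → ι → MvPolynomial σ K) (hd : ∀ a j, (g a j).totalDegree ≤ B)
    (hg : ∀ a k, ∑ j, C k j * g a j = 0)
    (hs : ∀ s : ι → MvPolynomial σ K, (∀ k, ∑ j, C k j * s j = 0) →
      ∃ c : α → MvPolynomial σ K, ∀ j, s j = ∑ a, c a * g a j) : KerBound C B := by
  classical
  obtain ⟨φ⟩ : Nonempty (α ↪ Fin B) := by
    apply Function.Embedding.nonempty_of_card_le
    simpa using hB
  have hext : ∀ a, Function.extend φ g 0 (φ a) = g a := fun a => φ.injective.extend_apply _ _ _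
  have hout : ∀ b, b ∉ Set.range φ → Function.extend φ g 0 b = 0 := fun b hb =>
    Function.extend_apply' _ _ _ hb
  refine ⟨Function.extend φ g 0, fun b j => ?_, fun b k => ?_, fun s h => ?_⟩
  · by_cases hb : b ∈ Set.range φ
    · obtain ⟨a, rfl⟩ := hb
      rw [hext]; exact hd a j
    · simp [hout b hb]
  · by_cases hb : b ∈ Set.range φ
    · obtain ⟨a, rfl⟩ := hb
      rw [hext]; exact hg a k
    · simp [hout b hb]
  · obtain ⟨c, hc⟩ := hs s h
    refine ⟨Function.extend φ c 0, fun j => ?_⟩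
    rw [hc, ← Finset.sum_subset (Finset.subset_univ (Finset.univ.map φ)), Finset.sum_map]
    · refine Finset.sum_congr rfl fun a _ => ?_
      rw [hext, φ.injective.extend_apply]
    · intro b _ hb
      have : b ∉ Set.range φ := by simpa using hb
      simp [hout b this]

theorem mono {B B' : ℕ} (h : KerBound C B) (hB : B ≤ B') : KerBound C B' := by
  obtain ⟨g, h1, h2, h3⟩ := h
  exact of_family (by simpa using hB) g (fun a j => (h1 a j).trans hB) h2 h3

theorem reindex {ι' κ' : Type*} [Fintype ι'] (e : ι' ≃ ι) (e' : κ' ≃ κ) {B : ℕ}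
    (h : KerBound (fun k j => C (e' k) (e j)) B) : KerBound C B := by
  obtain ⟨g, h1, h2, h3⟩ := h
  refine ⟨fun a j => g a (e.symm j), fun a j => h1 _ _, fun a k => ?_, fun s hs => ?_⟩
  · rw [← h2 a (e'.symm k), ← e.sum_comp]; simp
  · obtain ⟨c, hc⟩ := h3 (fun j => s (e j)) fun k => by
      rw [← hs (e' k), ← e.sum_comp]
    exact ⟨c, fun j => by rw [← hc]; simp⟩

theorem of_rows {κ' : Type*} {C' : κ' → ι → MvPolynomial σ K} {B : ℕ}
    (hC : ∀ s : ι → MvPolynomial σ K,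
      (∀ k, ∑ j, C k j * s j = 0) ↔ ∀ k, ∑ j, C' k j * s j = 0)
    (h : KerBound C' B) : KerBound C B := by
  obtain ⟨g, h1, h2, h3⟩ := h
  exact ⟨g, h1, fun a => (hC _).mpr (h2 a), fun s hs => h3 s ((hC s).mp hs)⟩

theorem map_equiv {B : ℕ} (φ : MvPolynomial σ K ≃+* MvPolynomial σ K)
    (hφ : ∀ f, (φ.symm f).totalDegree ≤ f.totalDegree)
    (h : KerBound (fun k j => φ (C k j)) B) : KerBound C B := by
  obtain ⟨g, h1, h2, h3⟩ := h
  refine ⟨fun a j => φ.symm (g a j), fun a j => (hφ _).trans (h1 _ _), fun a k => ?_,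
    fun s hs => ?_⟩
  · apply φ.injective
    simpa using h2 a k
  · obtain ⟨c, hc⟩ := h3 (fun j => φ (s j)) fun k => by
      simpa using congrArg φ (hs k)
    refine ⟨fun a => φ.symm (c a), fun j => φ.injective ?_⟩
    rw [hc]; simp

/-- Solving one relation and then substituting into the remaining ones. -/
theorem comp {κ' : Type*} {D : κ' → ι → MvPolynomial σ K} {d B₁ B₂ : ℕ}
    (hd : ∀ k j, (D k j).totalDegree ≤ d) (h : KerBound C B₁)
    (h' : ∀ E : κ' → Fin B₁ → MvPolynomial σ K, (∀ k j, (E k j).totalDegree ≤ d + B₁) →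
      KerBound E B₂) :
    KerBound (Sum.elim C D) (B₁ + B₂) := by
  obtain ⟨g, h1, h2, h3⟩ := h
  obtain ⟨γ, e1, e2, e3⟩ := h' (fun k a => ∑ j, D k j * g a j) fun k a =>
    totalDegree_finsetSum_le fun j _ => (totalDegree_mul _ _).trans
      (add_le_add (hd _ _) (h1 _ _))
  have key : ∀ (k : κ') (c : Fin B₁ → MvPolynomial σ K),
      ∑ j, D k j * ∑ a, c a * g a j = ∑ a, (∑ j, D k j * g a j) * c a := by
    intro k c
    simp only [Finset.mul_sum, Finset.sum_mul]
    rw [Finset.sum_comm]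
    exact Finset.sum_congr rfl fun _ _ => Finset.sum_congr rfl fun _ _ => by ring
  refine of_family (α := Fin B₂) (by simp) (fun b j => ∑ a, γ b a * g a j) (fun b j => ?_)
    (fun b k => ?_) fun s hs => ?_
  · refine totalDegree_finsetSum_le fun a _ => (totalDegree_mul _ _).trans ?_
    rw [add_comm B₁]
    exact add_le_add (e1 _ _) (h1 _ _)
  · cases k with
    | inl k =>
      simp only [Sum.elim_inl, Finset.mul_sum]
      rw [Finset.sum_comm]
      refine Finset.sum_eq_zero fun a _ => ?_
      rw [Finset.sum_congr rfl (g := fun j => γ b a * (C k j * g a j)) fun j _ => by ring,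
        ← Finset.mul_sum, h2, mul_zero]
    | inr k => rw [Sum.elim_inr, key]; exact e2 b k
  · obtain ⟨c, hc⟩ := h3 s fun k => hs (Sum.inl k)
    obtain ⟨c', hc'⟩ := e3 c fun k => by
      rw [← key, ← hs (Sum.inr k)]; simp [hc]
    refine ⟨c', fun j => ?_⟩
    rw [hc]
    simp only [hc', Finset.mul_sum, Finset.sum_mul]
    rw [Finset.sum_comm]
    exact Finset.sum_congr rfl fun _ _ => Finset.sum_congr rfl fun _ _ => by ring

end KerBound

end

section

open MvPolynomial

section Division

variable {K : Type*} [Field K] {k D : ℕ}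

theorem finSuccEquiv_rename_succ' (a : MvPolynomial (Fin k) K) :
    finSuccEquiv K k (rename Fin.succ a) = Polynomial.C a := by
  induction a using MvPolynomial.induction_on with
  | C a => simp [finSuccEquiv_apply]
  | add p q hp hq => simp [hp, hq]
  | mul_X p i hp => simp [hp, finSuccEquiv_X_succ]

theorem eq_sum_rename_coeff {d : ℕ} (R : MvPolynomial (Fin (k + 1)) K)
    (hR : ∀ i, d ≤ i → (finSuccEquiv K k R).coeff i = 0) :
    R = ∑ c : Fin d, rename Fin.succ ((finSuccEquiv K k R).coeff c) * X 0 ^ (c : ℕ) := by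
  apply (finSuccEquiv K k).injective
  simp only [map_sum, map_mul, map_pow, finSuccEquiv_rename_succ', finSuccEquiv_X_zero]
  rw [Fin.sum_univ_eq_sum_range
    (fun c => Polynomial.C ((finSuccEquiv K k R).coeff c) * Polynomial.X ^ c)]
  ext1 i
  simp only [Polynomial.finsetSum_coeff, Polynomial.coeff_C_mul_X_pow, Finset.sum_ite_eq,
    Finset.mem_range]
  split_ifs with h
  · rfl
  · exact hR i (not_lt.mp h)

theorem coeff_sum_rename {d : ℕ} (u : Fin d → MvPolynomial (Fin k) K) (b : Fin d) :
    (finSuccEquiv K k (∑ c : Fin d, rename Fin.succ (u c) * X 0 ^ (c : ℕ))).coeff b = u b := by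
  rw [map_sum, Polynomial.finsetSum_coeff, Finset.sum_eq_single b]
  · simp [finSuccEquiv_rename_succ', finSuccEquiv_X_zero]
  · intro c _ hc
    have : (b : ℕ) ≠ c := fun h => hc (Fin.ext h.symm)
    simp [finSuccEquiv_rename_succ', finSuccEquiv_X_zero, Polynomial.coeff_X_pow, this]
  · simp

theorem exists_eq_mul_add {f : MvPolynomial (Fin (k + 1)) K} {c : K} (hc : c ≠ 0)
    (hf : f.totalDegree ≤ D) (hfc : (finSuccEquiv K k f).coeff D = C c)
    (n : ℕ) (G : MvPolynomial (Fin (k + 1)) K)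
    (hG : ∀ i, n ≤ i → (finSuccEquiv K k G).coeff i = 0) :
    ∃ Q R : MvPolynomial (Fin (k + 1)) K, G = Q * f + R ∧ Q.totalDegree ≤ G.totalDegree ∧
      R.totalDegree ≤ G.totalDegree ∧ ∀ i, D ≤ i → (finSuccEquiv K k R).coeff i = 0 := by
  induction n generalizing G with
  | zero =>
    refine ⟨0, G, by simp, by simp, le_rfl, fun i _ => hG i (Nat.zero_le _)⟩
  | succ n ih =>
    rcases Nat.lt_or_ge n D with h | h
    · exact ⟨0, G, by simp, by simp, le_rfl, fun i hi => hG i (h.trans_le hi)⟩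
    set a := (finSuccEquiv K k G).coeff n with ha
    set q : MvPolynomial (Fin (k + 1)) K := C c⁻¹ * rename Fin.succ a * X 0 ^ (n - D) with hq
    have hqd : q.totalDegree + D ≤ G.totalDegree ∨ q = 0 := by
      by_cases h0 : a = 0
      · right; simp [hq, h0]
      · left
        have h1 := totalDegree_coeff_finSuccEquiv_add_le G n h0
        have h2 : q.totalDegree ≤ a.totalDegree + (n - D) := by
          refine (totalDegree_mul _ _).trans (add_le_add ((totalDegree_mul _ _).trans ?_) ?_)
          · simpa using totalDegree_rename_le _ _
          · simp
        rw [← ha] at h1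
        omega
    have hG' : (G - q * f).totalDegree ≤ G.totalDegree := by
      refine (totalDegree_sub _ _).trans (max_le le_rfl ?_)
      rcases hqd with h | h
      · exact (totalDegree_mul _ _).trans (by omega)
      · simp [h]
    have hΦ : finSuccEquiv K k (q * f) = Polynomial.C (C c⁻¹ * a) *
        (finSuccEquiv K k f * Polynomial.X ^ (n - D)) := by
      have hC : finSuccEquiv K k (C c⁻¹) = Polynomial.C (C c⁻¹) := by
        simp [finSuccEquiv_apply]
      simp only [hq, map_mul, map_pow, finSuccEquiv_rename_succ', finSuccEquiv_X_zero, hC]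
      ring
    have hfz : ∀ i, D < i → (finSuccEquiv K k f).coeff i = 0 := by
      intro i hi
      by_contra h0
      have := totalDegree_coeff_finSuccEquiv_add_le f i h0
      omega
    obtain ⟨Q, R, h1, h2, h3, h4⟩ := ih (G - q * f) (by
      intro i hi
      rw [map_sub, Polynomial.coeff_sub, hΦ, Polynomial.coeff_C_mul,
        Polynomial.coeff_mul_X_pow', if_pos (by omega)]
      rcases hi.eq_or_lt with rfl | hi
      · rw [Nat.sub_sub_self h, hfc, ← ha, mul_right_comm, ← C_mul, inv_mul_cancel₀ hc]
        simp
      · rw [hG i hi, hfz _ (by omega)]; simp)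
    refine ⟨Q + q, R, by linear_combination h1, ?_, h3.trans hG', h4⟩
    refine (totalDegree_add _ _).trans (max_le (h2.trans hG') ?_)
    rcases hqd with h | h
    · omega
    · simp [h]

theorem eq_zero_of_mul_add_eq_zero {f : MvPolynomial (Fin (k + 1)) K} {c : K} (hc : c ≠ 0)
    (hf : f.totalDegree ≤ D) (hfc : (finSuccEquiv K k f).coeff D = C c)
    {Q R : MvPolynomial (Fin (k + 1)) K} (h : Q * f + R = 0)
    (hR : ∀ i, D ≤ i → (finSuccEquiv K k R).coeff i = 0) : Q = 0 := by
  by_contra hQ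
  have hF : (finSuccEquiv K k f).natDegree = D := by
    apply le_antisymm
    · rw [Polynomial.natDegree_le_iff_coeff_eq_zero]
      intro i hi
      by_contra h0
      have := totalDegree_coeff_finSuccEquiv_add_le f i h0
      omega
    · apply Polynomial.le_natDegree_of_ne_zero
      rw [hfc]; simpa using hc
  have hQ' : finSuccEquiv K k Q ≠ 0 := by simpa using hQ
  have hf0 : finSuccEquiv K k f ≠ 0 := by
    intro h0
    rw [h0] at hfc
    exact hc (by simpa using hfc.symm)
  have h1 := congrArg (fun p => (finSuccEquiv K k p).coeff ((finSuccEquiv K k Q).natDegree + D)) h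
  simp only [map_add, map_mul, map_zero, Polynomial.coeff_add, Polynomial.coeff_zero] at h1
  rw [hR _ (by omega), add_zero] at h1
  have h2 := Polynomial.coeff_mul_degree_add_degree (finSuccEquiv K k Q) (finSuccEquiv K k f)
  rw [hF, h1] at h2
  rcases mul_eq_zero.mp h2.symm with h | h
  · exact hQ' (Polynomial.leadingCoeff_eq_zero.mp h)
  · exact hf0 (Polynomial.leadingCoeff_eq_zero.mp h)

end Division

end

section

open MvPolynomial

theorem KerBound.of_normal_form {K ι : Type*} [Field K] [Fintype ι] [DecidableEq ι] {k D d B : ℕ}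
    (hM : ∀ E : Fin d → ι × Fin d → MvPolynomial (Fin k) K,
      (∀ b j, (E b j).totalDegree ≤ d + d) → KerBound E B)
    (a : ι → MvPolynomial (Fin (k + 1)) K) (ha : ∀ j, (a j).totalDegree ≤ d) (hD : D ≤ d)
    {j₀ : ι} {c : K} (hc : c ≠ 0) (hf : (a j₀).totalDegree ≤ D)
    (hfc : (finSuccEquiv K k (a j₀)).coeff D = C c) :
    KerBound (fun _ : Unit => a) (Fintype.card ι + B + (d + d)) := by
  have hdiv : ∀ x : ι × Fin d, ∃ Q R : MvPolynomial (Fin (k + 1)) K,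
      a x.1 * X 0 ^ (x.2 : ℕ) = Q * a j₀ + R ∧ Q.totalDegree ≤ d + d ∧ R.totalDegree ≤ d + d ∧
        ∀ i, D ≤ i → (finSuccEquiv K k R).coeff i = 0 := by
    intro x
    have hdeg : (a x.1 * X 0 ^ (x.2 : ℕ)).totalDegree ≤ d + d := by
      refine (totalDegree_mul _ _).trans (add_le_add (ha _) ?_)
      rw [totalDegree_X_pow]; exact x.2.2.le
    obtain ⟨Q, R, h1, h2, h3, h4⟩ := exists_eq_mul_add hc hf hfc
      ((finSuccEquiv K k (a x.1 * X 0 ^ (x.2 : ℕ))).natDegree + 1) (a x.1 * X 0 ^ (x.2 : ℕ))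
      fun i hi => Polynomial.coeff_eq_zero_of_natDegree_lt hi
    exact ⟨Q, R, h1, h2.trans hdeg, h3.trans hdeg, h4⟩
  choose Q R hQR hQ hR hRD using hdiv
  let E : Fin d → ι × Fin d → MvPolynomial (Fin k) K := fun b x =>
    (finSuccEquiv K k (R x)).coeff b
  obtain ⟨γ, g1, g2, g3⟩ := hM E fun b x => by
    by_cases h0 : (finSuccEquiv K k (R x)).coeff b = 0
    · simp [E, h0]
    · have := totalDegree_coeff_finSuccEquiv_add_le (R x) b h0
      exact (Nat.le_of_add_right_le this).trans (hR x)
  let v : (ι × Fin d → MvPolynomial (Fin k) K) → ι → MvPolynomial (Fin (k + 1)) K := fun r j =>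
    ∑ e : Fin d, rename Fin.succ (r (j, e)) * X 0 ^ (e : ℕ) -
      if j = j₀ then ∑ x, rename Fin.succ (r x) * Q x else 0
  have hR' : ∀ r : ι × Fin d → MvPolynomial (Fin k) K, ∑ x, rename Fin.succ (r x) * R x =
      ∑ b : Fin d, rename Fin.succ (∑ x, E b x * r x) * X 0 ^ (b : ℕ) := by
    intro r
    simp only [map_sum, Finset.sum_mul]
    rw [Finset.sum_comm]
    refine Finset.sum_congr rfl fun x _ => ?_
    conv_lhs => rw [eq_sum_rename_coeff (d := d) (R x) fun i hi => hRD x i (hD.trans hi)]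
    rw [Finset.mul_sum]
    refine Finset.sum_congr rfl fun b _ => ?_
    simp only [map_mul, E]
    ring
  have ht : ∀ r : ι × Fin d → MvPolynomial (Fin k) K,
      ∑ j, a j * ∑ e : Fin d, rename Fin.succ (r (j, e)) * X 0 ^ (e : ℕ) =
        (∑ x, rename Fin.succ (r x) * Q x) * a j₀ + ∑ x, rename Fin.succ (r x) * R x := by
    intro r
    rw [Finset.sum_mul, ← Finset.sum_add_distrib, Fintype.sum_prod_type]
    refine Finset.sum_congr rfl fun j _ => ?_
    rw [Finset.mul_sum]
    refine Finset.sum_congr rfl fun e _ => ?_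
    linear_combination rename Fin.succ (r (j, e)) * hQR (j, e)
  have hv : ∀ r, ∑ j, a j * v r j = ∑ x, rename Fin.succ (r x) * R x := by
    intro r
    simp only [v, mul_sub, Finset.sum_sub_distrib, ht, mul_ite, mul_zero, Finset.sum_ite_eq',
      Finset.mem_univ, if_true]
    ring
  have hvlin : ∀ (c' : Fin B → MvPolynomial (Fin k) K) j,
      v (fun x => ∑ b, c' b * γ b x) j = ∑ b, rename Fin.succ (c' b) * v (γ b) j := by
    intro c' j
    simp only [v, map_sum, map_mul, mul_sub, Finset.sum_sub_distrib, mul_ite, mul_zero]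
    congr 1
    · simp only [Finset.mul_sum, Finset.sum_mul]
      rw [Finset.sum_comm]
      exact Finset.sum_congr rfl fun _ _ => Finset.sum_congr rfl fun _ _ => by ring
    · split_ifs
      · simp only [Finset.mul_sum, Finset.sum_mul]
        rw [Finset.sum_comm]
        exact Finset.sum_congr rfl fun _ _ => Finset.sum_congr rfl fun _ _ => by ring
      · simp
  refine KerBound.of_family (α := ι ⊕ Fin B) (by simp)
    (Sum.elim (fun i j => (if j = i then a j₀ else 0) - if j = j₀ then a i else 0)
      fun b => v (γ b)) (fun x j => ?_) (fun x _ => ?_) fun s hs => ?_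
  · have hren : ∀ f : MvPolynomial (Fin k) K, (rename Fin.succ f).totalDegree ≤ f.totalDegree :=
      fun f => totalDegree_rename_le _ _
    cases x with
    | inl i =>
      have := ha j₀
      have := ha i
      refine (totalDegree_sub _ _).trans (max_le ?_ ?_) <;> split_ifs <;> first | omega | simp
    | inr b =>
      refine (totalDegree_sub _ _).trans (max_le ?_ ?_)
      · refine totalDegree_finsetSum_le fun e _ => (totalDegree_mul _ _).trans ?_
        have := (hren _).trans (g1 b (j, e))
        rw [totalDegree_X_pow]
        omega
      · split_ifs
        · refine totalDegree_finsetSum_le fun e _ => (totalDegree_mul _ _).trans ?_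
          have := (hren _).trans (g1 b e)
          have := hQ e
          omega
        · simp
  · cases x with
    | inl i => simp [mul_sub, Finset.sum_sub_distrib, mul_comm]
    | inr b => simp [hv, hR', g2]
  · have hs' : ∑ j, a j * s j = 0 := hs ()
    choose q t hqt _ _ htD using fun j => exists_eq_mul_add hc hf hfc
      ((finSuccEquiv K k (s j)).natDegree + 1) (s j)
      fun i hi => Polynomial.coeff_eq_zero_of_natDegree_lt hi
    set r : ι × Fin d → MvPolynomial (Fin k) K := fun x => (finSuccEquiv K k (t x.1)).coeff x.2
      with hr
    have htr : ∀ j, t j = ∑ e : Fin d, rename Fin.succ (r (j, e)) * X 0 ^ (e : ℕ) := fun j =>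
      eq_sum_rename_coeff (t j) fun i hi => htD j i (hD.trans hi)
    have h1 := ht r
    simp only [← htr] at h1
    have h2 : (∑ j, q j * a j + ∑ x, rename Fin.succ (r x) * Q x) * a j₀ +
        ∑ x, rename Fin.succ (r x) * R x = 0 := by
      rw [add_mul, add_assoc, ← h1, Finset.sum_mul, ← Finset.sum_add_distrib, ← hs']
      refine Finset.sum_congr rfl fun j _ => ?_
      linear_combination -a j * hqt j
    have h3 := eq_zero_of_mul_add_eq_zero hc hf hfc h2 fun i hi => by
      rw [map_sum, Polynomial.finsetSum_coeff]
      refine Finset.sum_eq_zero fun x _ => ?_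
      rw [map_mul, finSuccEquiv_rename_succ', Polynomial.coeff_C_mul, hRD x i hi, mul_zero]
    rw [h3, zero_mul, zero_add, hR'] at h2
    obtain ⟨c', hc'⟩ := g3 r fun b => by
      have h4 := congrArg (fun p => (finSuccEquiv K k p).coeff b) h2
      rwa [coeff_sum_rename, map_zero, Polynomial.coeff_zero] at h4
    refine ⟨Sum.elim q fun b => rename Fin.succ (c' b), fun j => ?_⟩
    have h5 : v r j = ∑ b, rename Fin.succ (c' b) * v (γ b) j := by
      have h6 := hvlin c' j
      rwa [← funext hc'] at h6
    rw [Fintype.sum_sum_type]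
    simp only [Sum.elim_inl, Sum.elim_inr, ← h5, mul_sub, Finset.sum_sub_distrib, mul_ite,
      mul_zero, Finset.sum_ite_eq, Finset.mem_univ, if_true]
    simp only [v, ← htr]
    split_ifs with hj
    · linear_combination hqt j + h3
    · simpa using hqt j

end

section

open MvPolynomial


theorem MvPolynomial.aeval_algebraMap_mul_of_isHomogeneous {K σ S : Type*} [Field K] [CommRing S]
    [Algebra K S] {F : MvPolynomial σ K} {i : ℕ} (hF : F.IsHomogeneous i) (p : σ → K) (t : S) :
    aeval (fun l => algebraMap K S (p l) * t) F = algebraMap K S (eval p F) * t ^ i := by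
  rw [aeval_def, eval₂_eq, eval_eq, map_sum, Finset.sum_mul]
  refine Finset.sum_congr rfl fun d hd => ?_
  have h2 : ∑ l ∈ d.support, d l = i := by
    rw [← hF (mem_support_iff.mp hd), Finsupp.weight_apply, Finsupp.sum]; simp
  simp only [mul_pow, Finset.prod_mul_distrib, Finset.prod_pow_eq_pow_sum, h2, map_mul, map_prod,
    map_pow]
  ring

theorem exists_shear_coeff_eq_C {K : Type*} [Field K] [Infinite K] {k : ℕ}
    {f : MvPolynomial (Fin (k + 1)) K} (hf : f ≠ 0) :
    ∃ (p : Fin (k + 1) → K) (c : K), c ≠ 0 ∧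
      (finSuccEquiv K k (shear 0 p f)).coeff f.totalDegree = C c := by
  have hh : homogeneousComponent f.totalDegree f ≠ 0 := by
    obtain ⟨m, hm, hm'⟩ := Finset.exists_mem_eq_sup f.support (support_nonempty.mpr hf)
      fun s => s.sum fun _ e => e
    intro h0
    have := congrArg (coeff m) h0
    rw [coeff_homogeneousComponent, if_pos, coeff_zero] at this
    · exact mem_support_iff.mp hm this
    · exact hm'.symm
  obtain ⟨p, hp0, hp⟩ := exists_eval_ne_zero_of_isHomogeneous
    (homogeneousComponent_isHomogeneous _ f) hh 0
  set D := f.totalDegree with hD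
  set G := (finSuccEquiv K k (shear 0 p f)).coeff D with hG
  have hG0 : G.totalDegree = 0 := by
    by_cases h0 : G = 0
    · simp [h0]
    · have h1 := totalDegree_coeff_finSuccEquiv_add_le (shear 0 p f) D h0
      rw [← hG] at h1
      have h2 := totalDegree_shearHom_le 0 p f
      have h3 : (shear 0 p f).totalDegree ≤ f.totalDegree := h2
      omega
  rw [totalDegree_eq_zero_iff_eq_C] at hG0
  refine ⟨p, _, ?_, hG0⟩
  let ε : MvPolynomial (Fin (k + 1)) K →ₐ[K] Polynomial K :=
    aeval (Fin.cons Polynomial.X fun _ => 0)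
  have hε : ∀ g, ε g = (finSuccEquiv K k g).map constantCoeff := by
    intro g
    induction g using MvPolynomial.induction_on with
    | C a => simp [ε, finSuccEquiv_apply]
    | add p q hp hq => simp [hp, hq]
    | mul_X p i hp =>
      rw [map_mul, map_mul, Polynomial.map_mul, hp]
      congr 1
      refine Fin.cases ?_ (fun i => ?_) i
      · simp [ε, finSuccEquiv_X_zero]
      · simp [ε, finSuccEquiv_X_succ]
  have h1 : ε (shear 0 p f) = ∑ i ∈ Finset.range (D + 1),
      algebraMap K (Polynomial K) (eval p (homogeneousComponent i f)) * Polynomial.X ^ i := by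
    have h2 : (ε.comp (shear 0 p).toAlgHom) =
        aeval (fun l => algebraMap K (Polynomial K) (p l) * Polynomial.X) := by
      refine algHom_ext fun l => ?_
      refine Fin.cases ?_ (fun i => ?_) l
      · simp [ε, shear, shearHom, hp0]
      · simp [ε, shear, shearHom, Fin.succ_ne_zero]
    have h3 : ε (shear 0 p f) = (ε.comp (shear 0 p).toAlgHom) f := rfl
    rw [h3, h2]
    conv_lhs => rw [← sum_homogeneousComponent f]
    rw [map_sum]
    exact Finset.sum_congr rfl fun i _ =>
      aeval_algebraMap_mul_of_isHomogeneous (homogeneousComponent_isHomogeneous i f) p _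
  have h4 := congrArg (fun q => Polynomial.coeff q D) (hε (shear 0 p f))
  simp only [Polynomial.coeff_map, h1, Polynomial.finsetSum_coeff] at h4
  rw [← hG, Finset.sum_eq_single D] at h4
  · rw [← constantCoeff_eq, ← h4]
    simpa using hp
  · intro b _ hb
    simp [Polynomial.coeff_X_pow, hb.symm]
  · simp

theorem KerBound.zero {K σ ι κ : Type*} [CommRing K] [Fintype ι] [DecidableEq ι]
    {C : κ → ι → MvPolynomial σ K} (hC : ∀ k j, C k j = 0) : KerBound C (Fintype.card ι) := by
  refine of_family (α := ι) le_rfl (fun i j => if j = i then 1 else 0) (fun a j => ?_)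
    (by simp [hC]) fun s _ => ⟨s, fun j => by simp⟩
  split_ifs <;> simp

/-- Bounds for the relations among the columns of a matrix over `K[x_1, …, x_k]`, uniform in the
infinite field `K`. -/
theorem exists_kerBound_of_infinite (k : ℕ) : ∀ p q d : ℕ, ∃ B : ℕ,
    ∀ (K : Type u) [Field K] [Infinite K] (A : Fin q → Fin p → MvPolynomial (Fin k) K),
      (∀ i j, (A i j).totalDegree ≤ d) → KerBound A B := by
  have step : ∀ k : ℕ, (∀ p d : ℕ, ∃ B : ℕ, ∀ (K : Type u) [Field K] [Infinite K]
      (a : Fin p → MvPolynomial (Fin k) K), (∀ j, (a j).totalDegree ≤ d) →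
        KerBound (fun _ : Unit => a) B) → ∀ p q d : ℕ, ∃ B : ℕ,
    ∀ (K : Type u) [Field K] [Infinite K] (A : Fin q → Fin p → MvPolynomial (Fin k) K),
      (∀ i j, (A i j).totalDegree ≤ d) → KerBound A B := by
    intro k h1 p q
    induction q generalizing p with
    | zero =>
      intro d
      exact ⟨p, fun K _ _ A _ => by simpa using KerBound.zero (C := A) fun i => i.elim0⟩
    | succ q ih =>
      intro d
      obtain ⟨B₁, hB₁⟩ := h1 p d
      obtain ⟨B₂, hB₂⟩ := ih B₁ (d + B₁)
      refine ⟨B₁ + B₂, fun K _ _ A hA => ?_⟩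
      refine KerBound.of_rows (fun s => ?_) (KerBound.comp (D := fun i j => A (Fin.succ i) j)
        (fun i j => hA _ _) (hB₁ K (A 0) (hA 0)) (fun E hE => hB₂ K E hE))
      rw [Fin.forall_fin_succ, Sum.forall]
      simp
  induction k with
  | zero =>
    refine step 0 fun p d => ⟨p + d, fun K _ _ a ha => ?_⟩
    by_cases h0 : ∀ j, a j = 0
    · exact (KerBound.zero (C := fun _ : Unit => a) fun _ => h0).mono (by simp)
    · push Not at h0
      obtain ⟨j₀, hj₀⟩ := h0
      obtain ⟨b, hb⟩ : ∃ b, a j₀ * b = 1 := by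
        rw [eq_C_of_isEmpty (a j₀)] at hj₀ ⊢
        refine ⟨C (coeff 0 (a j₀))⁻¹, ?_⟩
        rw [← C_mul, mul_inv_cancel₀, C_1]
        intro h; rw [h] at hj₀; simp at hj₀
      have hdeg : ∀ f : MvPolynomial (Fin 0) K, f.totalDegree ≤ p + d := fun f => by
        rw [eq_C_of_isEmpty f, totalDegree_C]; exact Nat.zero_le _
      refine KerBound.of_family (α := Fin p) (by simp)
        (fun i j => (if j = i then 1 else 0) - if j = j₀ then a i * b else 0) (fun _ _ => hdeg _)
        (fun i _ => ?_) fun s hs => ⟨s, fun j => ?_⟩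
      · simp [mul_sub, Finset.sum_sub_distrib]
        linear_combination -a i * hb
      · have hs' := hs ()
        simp only [mul_sub, Finset.sum_sub_distrib, mul_ite, mul_one, mul_zero,
          Finset.sum_ite_eq, Finset.mem_univ, if_true]
        split_ifs with h
        · have : ∑ x, s x * (a x * b) = (∑ x, a x * s x) * b := by
            rw [Finset.sum_mul]; exact Finset.sum_congr rfl fun _ _ => by ring
          rw [this, hs']; ring
        · simp
  | succ k ih =>
    refine step (k + 1) fun p d => ?_
    obtain ⟨B, hB⟩ : ∃ B, ∀ d' ≤ d, ∀ (K : Type u) [Field K] [Infinite K]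
        (A : Fin d → Fin p × Fin d → MvPolynomial (Fin k) K),
        (∀ i j, (A i j).totalDegree ≤ d + d) → KerBound A B := by
      obtain ⟨B, hB⟩ := ih (p * d) d (d + d)
      exact ⟨B, fun _ _ K _ _ A hA => KerBound.reindex finProdFinEquiv.symm (Equiv.refl _)
        (hB K _ fun i j => hA _ _)⟩
    refine ⟨p + B + (d + d), fun K _ _ a ha => ?_⟩
    by_cases h0 : ∀ j, a j = 0
    · exact (KerBound.zero (C := fun _ : Unit => a) fun _ => h0).mono (by simp; omega)
    · push Not at h0
      obtain ⟨j₀, hj₀⟩ := h0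
      obtain ⟨P, c, hc, hP⟩ := exists_shear_coeff_eq_C hj₀
      refine KerBound.map_equiv (shear 0 P).toRingEquiv
        (fun f => totalDegree_shearHom_le 0 (-P) f) ?_
      have := KerBound.of_normal_form (d := d) (fun E hE => hB d le_rfl K E hE)
        (fun j => shear 0 P (a j)) (fun j => (totalDegree_shearHom_le 0 P _).trans (ha j))
        (ha j₀) hc (totalDegree_shearHom_le 0 P _) hP
      simpa using this

end

section

open MvPolynomial

section WeightLT

variable {K Y : Type*} [Field K] {e : Y → ℕ}

/-- All monomials of `Q` have weight less than `n`. -/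
def WeightLT (e : Y → ℕ) (n : ℕ) (Q : MvPolynomial Y K) : Prop :=
  ∀ m, coeff m Q ≠ 0 → Finsupp.weight e m < n

namespace WeightLT

variable {P Q : MvPolynomial Y K} {n n' : ℕ}

theorem zero : WeightLT e n (0 : MvPolynomial Y K) := fun m hm => by simp at hm

theorem add (hP : WeightLT e n P) (hQ : WeightLT e n Q) : WeightLT e n (P + Q) := by
  intro m hm
  by_cases h : coeff m P = 0
  · exact hQ m fun h' => hm (by rw [coeff_add, h, h', add_zero])
  · exact hP m h

theorem neg (hP : WeightLT e n P) : WeightLT e n (-P) := by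
  intro m hm
  exact hP m (by simpa using hm)

theorem sub (hP : WeightLT e n P) (hQ : WeightLT e n Q) : WeightLT e n (P - Q) := by
  rw [sub_eq_add_neg]; exact hP.add hQ.neg

theorem sum {ι : Type*} {s : Finset ι} {f : ι → MvPolynomial Y K}
    (h : ∀ i ∈ s, WeightLT e n (f i)) : WeightLT e n (∑ i ∈ s, f i) :=
  Finset.sum_induction _ _ (fun _ _ => add) zero h

theorem of_isWeightedHomogeneous (hP : IsWeightedHomogeneous e P n') (h : n' < n) :
    WeightLT e n P := fun _ hm => (hP hm).trans_lt h

theorem exists_of_mul_coeff_ne_zero {m : Y →₀ ℕ} (h : coeff m (P * Q) ≠ 0) :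
    ∃ a b, a + b = m ∧ coeff a P ≠ 0 ∧ coeff b Q ≠ 0 := by
  classical
  rw [coeff_mul] at h
  obtain ⟨x, hx, hx'⟩ := Finset.exists_ne_zero_of_sum_ne_zero h
  exact ⟨x.1, x.2, Finset.HasAntidiagonal.mem_antidiagonal.mp hx, left_ne_zero_of_mul hx',
    right_ne_zero_of_mul hx'⟩

theorem mul (hP : WeightLT e n P) (hQ : WeightLT e n' Q) : WeightLT e (n + n') (P * Q) := by
  intro m hm
  obtain ⟨a, b, rfl, ha, hb⟩ := exists_of_mul_coeff_ne_zero hm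
  have := hP a ha
  have := hQ b hb
  rw [map_add]; omega

theorem homogeneous_mul (hP : IsWeightedHomogeneous e P n) (hQ : WeightLT e n' Q) :
    WeightLT e (n + n') (P * Q) := by
  intro m hm
  obtain ⟨a, b, rfl, ha, hb⟩ := exists_of_mul_coeff_ne_zero hm
  have := hP ha
  have := hQ b hb
  rw [map_add]; omega

theorem aeval_sub_mul {P' Q' : MvPolynomial Y K} (hP : IsWeightedHomogeneous e P n)
    (hQ : IsWeightedHomogeneous e Q n') (hP' : WeightLT e n (P' - P))
    (hQ' : WeightLT e n' (Q' - Q)) : WeightLT e (n + n') (P' * Q' - P * Q) := by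
  have h : P' * Q' - P * Q = (P' - P) * (Q' - Q) + P * (Q' - Q) + Q * (P' - P) := by ring
  rw [h]
  refine ((hP'.mul hQ').add (homogeneous_mul hP hQ')).add ?_
  rw [add_comm]
  exact homogeneous_mul hQ hP'

theorem aeval_monomial_sub {q : Y → MvPolynomial Y K} (hq : ∀ j, WeightLT e (e j) (q j))
    (m : Y →₀ ℕ) : WeightLT e (Finsupp.weight e m)
      (aeval (fun j => X j + q j) (monomial m (1 : K)) - monomial m 1) := by
  induction m using Finsupp.induction_linear with
  | zero => simpa using zero
  | add f g hf hg =>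
    have h : (monomial (f + g) (1 : K)) = monomial f 1 * monomial g 1 := by
      rw [monomial_mul, one_mul]
    rw [h, map_mul, map_add]
    exact aeval_sub_mul (isWeightedHomogeneous_monomial _ _ _ rfl)
      (isWeightedHomogeneous_monomial _ _ _ rfl) hf hg
  | single j n =>
    induction n with
    | zero => simpa using zero
    | succ n ih =>
      have h : (monomial (Finsupp.single j (n + 1)) (1 : K)) =
          monomial (Finsupp.single j n) 1 * X j := by
        rw [X, monomial_mul, one_mul, Finsupp.single_add]
      rw [h, map_mul, Finsupp.single_add, map_add]
      refine aeval_sub_mul (isWeightedHomogeneous_monomial _ _ _ rfl) ?_ ih ?_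
      · convert isWeightedHomogeneous_X K e j
        simp [Finsupp.weight_apply]
      · simpa [Finsupp.weight_apply] using hq j

theorem aeval_sub {q : Y → MvPolynomial Y K} (hq : ∀ j, WeightLT e (e j) (q j))
    (hP : IsWeightedHomogeneous e P n) :
    WeightLT e n (aeval (fun j => X j + q j) P - P) := by
  have h : aeval (fun j => X j + q j) P - P = ∑ m ∈ P.support,
      C (coeff m P) * (aeval (fun j => X j + q j) (monomial m (1 : K)) - monomial m 1) := by
    conv_lhs => rw [P.as_sum, map_sum, ← Finset.sum_sub_distrib]
    refine Finset.sum_congr rfl fun m _ => ?_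
    have : monomial m (coeff m P) = C (coeff m P) * monomial m 1 := by
      rw [C_mul_monomial, mul_one]
    rw [this, map_mul, mul_sub, algHom_C, algebraMap_eq]
  rw [h]
  refine sum fun m hm => ?_
  have := homogeneous_mul (isWeightedHomogeneous_C e (coeff m P)) (aeval_monomial_sub hq m)
  rwa [hP (mem_support_iff.mp hm), zero_add] at this

end WeightLT

theorem pderiv_aeval_of_vars_subset {K Y : Type*} [Field K] [DecidableEq Y]
    (v : Y → MvPolynomial Y K) (n : Y) {T : Finset Y} {P : MvPolynomial Y K}
    (hP : ↑P.vars ⊆ (T : Set Y)) :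
    pderiv n (aeval v P) = ∑ j ∈ T, aeval v (pderiv j P) * pderiv n (v j) := by
  rw [← mem_supported (R := K), supported_eq_adjoin_X] at hP
  induction hP using Algebra.adjoin_induction with
  | mem x hx =>
    obtain ⟨j, hj, rfl⟩ := hx
    rw [Finset.sum_eq_single j]
    · simp
    · intro i _ hi
      simp [pderiv_X_of_ne hi.symm]
    · exact fun h => (h hj).elim
  | algebraMap r => simp [algebraMap_eq]
  | add x y _ _ hx hy => simp only [map_add, hx, hy, add_mul, Finset.sum_add_distrib]
  | mul x y _ _ hx hy =>
    rw [map_mul, pderiv_mul, hx, hy, Finset.sum_mul, Finset.mul_sum, ← Finset.sum_add_distrib]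
    refine Finset.sum_congr rfl fun j _ => ?_
    rw [pderiv_mul, map_add, map_mul, map_mul]
    ring

theorem exists_eq_sum_range_weightedHomogeneousComponent {K Y : Type*} [Field K] (e : Y → ℕ)
    (F : MvPolynomial Y K) :
    ∃ n, F = ∑ i ∈ Finset.range n, weightedHomogeneousComponent e i F := by
  refine ⟨weightedTotalDegree e F + 1, ?_⟩
  conv_lhs => rw [← sum_weightedHomogeneousComponent e F]
  refine finsum_eq_sum_of_support_subset _ ?_
  intro i hi
  by_contra h
  refine hi (weightedHomogeneousComponent_eq_zero _ _ ?_)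
  simp only [Finset.coe_range, Set.mem_Iio, not_lt] at h
  omega

end WeightLT

end

section

open MvPolynomial


/-- The subspaces `𝒜 i` form a grading of the `K`-algebra `S` with `𝒜 0 = K`. -/
structure IsConnectedGrading {K S : Type*} [Field K] [CommRing S] [Algebra K S]
    (𝒜 : ℕ → Submodule K S) : Prop where
  zero : ∀ f ∈ 𝒜 0, ∃ c, algebraMap K S c = f
  one : 1 ∈ 𝒜 0
  mul : ∀ i j f g, f ∈ 𝒜 i → g ∈ 𝒜 j → f * g ∈ 𝒜 (i + j)
  exists_sum : ∀ f, ∃ (n : ℕ) (a : ℕ → S), (∀ i, a i ∈ 𝒜 i) ∧ f = ∑ i ∈ Finset.range n, a i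
  eq_zero : ∀ (n : ℕ) (a : ℕ → S), (∀ i, a i ∈ 𝒜 i) → ∑ i ∈ Finset.range n, a i = 0 →
    ∀ i < n, a i = 0

namespace IsConnectedGrading

variable {K Y : Type*} {S : Type v} [Field K] [CommRing S] [Algebra K S] {𝒜 : ℕ → Submodule K S}
  (h𝒜 : IsConnectedGrading 𝒜) {e : Y → ℕ} {y : Y → S}

include h𝒜

theorem algebraMap_mem (c : K) : algebraMap K S c ∈ 𝒜 0 := by
  rw [Algebra.algebraMap_eq_smul_one]; exact (𝒜 0).smul_mem c h𝒜.one

theorem pow_mem {i : ℕ} {f : S} (hf : f ∈ 𝒜 i) (n : ℕ) : f ^ n ∈ 𝒜 (n * i) := by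
  induction n with
  | zero => simpa using h𝒜.one
  | succ n ih => rw [pow_succ, add_mul, one_mul]; exact h𝒜.mul _ _ _ _ ih hf

theorem aeval_mem (hy : ∀ j, y j ∈ 𝒜 (e j)) {i : ℕ} {F : MvPolynomial Y K}
    (hF : IsWeightedHomogeneous e F i) : aeval y F ∈ 𝒜 i := by
  classical
  rw [F.as_sum, map_sum]
  refine Submodule.sum_mem _ fun m hm => ?_
  rw [aeval_monomial, ← zero_add i]
  refine h𝒜.mul _ _ _ _ (h𝒜.algebraMap_mem _) ?_
  rw [← hF (mem_support_iff.mp hm)]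
  clear hm
  induction m using Finsupp.induction_linear with
  | zero => simpa using h𝒜.one
  | add f g hf hg =>
    rw [Finsupp.prod_add_index' (by simp) (fun _ _ _ => pow_add _ _ _), map_add]
    exact h𝒜.mul _ _ _ _ hf hg
  | single j n =>
    rw [Finsupp.prod_single_index (by simp)]
    simpa [Finsupp.weight_apply] using h𝒜.pow_mem (hy j) n

theorem exists_homogeneous_lift (hy : ∀ j, y j ∈ 𝒜 (e j)) {i : ℕ} {F : MvPolynomial Y K}
    (hF : aeval y F ∈ 𝒜 i) :
    aeval y (weightedHomogeneousComponent e i F) = aeval y F := by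
  obtain ⟨n, hn⟩ := exists_eq_sum_range_weightedHomogeneousComponent e F
  have hmem : ∀ j, aeval y (weightedHomogeneousComponent e j F) ∈ 𝒜 j := fun j =>
    h𝒜.aeval_mem hy (weightedHomogeneousComponent_isWeightedHomogeneous j F)
  have hn' : F = ∑ j ∈ Finset.range (max n (i + 1)), weightedHomogeneousComponent e j F := by
    have h : ∀ j, n ≤ j → weightedHomogeneousComponent e j F = 0 := by
      intro j hj
      rw [hn, map_sum]
      refine Finset.sum_eq_zero fun l hl => ?_
      rw [(weightedHomogeneousComponent_isWeightedHomogeneous l F).weightedHomogeneousComponent_ne]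
      have := Finset.mem_range.mp hl
      omega
    conv_lhs => rw [hn]
    refine Finset.sum_subset (Finset.range_mono (le_max_left _ _)) fun j _ hj => h j ?_
    simpa using hj
  have h := h𝒜.eq_zero (max n (i + 1))
    (fun j => aeval y (weightedHomogeneousComponent e j F) - if j = i then aeval y F else 0)
    (fun j => by
      split_ifs with hj
      · subst hj; exact Submodule.sub_mem _ (hmem _) hF
      · simpa using hmem j)
    (by
      rw [Finset.sum_sub_distrib, ← map_sum, ← hn', Finset.sum_ite_eq', if_pos (by simp),
        sub_self]) i (by simp)
  simpa [sub_eq_zero] using h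

theorem eq_zero_of_weightLT (hy : ∀ j, y j ∈ 𝒜 (e j)) {n : ℕ}
    (hn : ∀ i < n, ∀ P : MvPolynomial Y K, IsWeightedHomogeneous e P i → aeval y P = 0 → P = 0)
    {Q : MvPolynomial Y K} (hQ : WeightLT e n Q) (h0 : aeval y Q = 0) : Q = 0 := by
  have h : ∀ i, weightedHomogeneousComponent e i Q = 0 := by
    intro i
    rcases lt_or_ge i n with hi | hi
    · refine hn i hi _ (weightedHomogeneousComponent_isWeightedHomogeneous i Q) ?_
      rw [h𝒜.exists_homogeneous_lift hy (by rw [h0]; exact Submodule.zero_mem _), h0]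
    · refine weightedHomogeneousComponent_eq_zero' i Q fun m hm => ?_
      have := hQ m (mem_support_iff.mp hm)
      omega
  obtain ⟨n, hn⟩ := exists_eq_sum_range_weightedHomogeneousComponent e Q
  rw [hn]; simp [h]

/-- The subalgebra generated by the pieces of degree less than `n`. -/
def _root_.lowSubalgebra (𝒜 : ℕ → Submodule K S) (n : ℕ) : Subalgebra K S :=
  Algebra.adjoin K (⋃ i < n, (𝒜 i : Set S))

theorem exists_generators : ∃ (Y : Type v) (e : Y → ℕ) (y : Y → S),
    (∀ j, 0 < e j) ∧ (∀ j, y j ∈ 𝒜 (e j)) ∧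
    Function.Surjective (aeval (R := K) y) ∧
    ∀ (n : ℕ) (c : Y →₀ K), (∀ j ∈ c.support, e j = n) →
      (c.sum fun j a => a • y j) ∈ lowSubalgebra 𝒜 n → c = 0 := by
  have hC : ∀ i, ∃ C : Submodule K S, (𝒜 i ⊓ (lowSubalgebra 𝒜 i).toSubmodule) ⊓ C = ⊥ ∧
      (𝒜 i ⊓ (lowSubalgebra 𝒜 i).toSubmodule) ⊔ C = 𝒜 i := by
    intro i
    obtain ⟨C, hC⟩ := exists_isCompl (𝒜 i ⊓ (lowSubalgebra 𝒜 i).toSubmodule)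
    refine ⟨C ⊓ 𝒜 i, ?_, ?_⟩
    · rw [← inf_assoc, hC.inf_eq_bot, bot_inf_eq]
    · rw [← sup_inf_assoc_of_le C inf_le_left, hC.sup_eq_top, top_inf_eq]
  choose C hC₁ hC₂ using hC
  let b := fun i => Module.Basis.ofVectorSpace K (C i)
  let Y := Σ i : ℕ, Module.Basis.ofVectorSpaceIndex K (C (i + 1))
  let y : Y → S := fun j => (b (j.1 + 1) j.2 : S)
  have hCA : ∀ i, C i ≤ 𝒜 i := fun i => le_sup_right.trans (hC₂ i).le
  refine ⟨Y, fun j => j.1 + 1, y, fun j => Nat.succ_pos _, fun j => hCA _ (b _ j.2).2, ?_, ?_⟩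
  · have hle : ∀ i, 𝒜 i ≤ Subalgebra.toSubmodule (aeval (R := K) y).range := by
      intro i
      induction i using Nat.strong_induction_on with
      | _ i ih =>
        rcases i with _ | i
        · intro f hf
          obtain ⟨c, rfl⟩ := h𝒜.zero f hf
          exact Subalgebra.algebraMap_mem _ c
        · rw [← hC₂ (i + 1)]
          refine sup_le (inf_le_right.trans ?_) ?_
          · refine Algebra.adjoin_le ?_
            refine Set.iUnion₂_subset fun l hl => ih l hl
          · intro f hf
            have h1 := (b (i + 1)).mem_span (⟨f, hf⟩ : C (i + 1))
            have h2 := Submodule.mem_map_of_mem (f := (C (i + 1)).subtype) h1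
            rw [Submodule.map_span] at h2
            refine (Submodule.span_le.mpr ?_) h2
            rintro _ ⟨_, ⟨j, rfl⟩, rfl⟩
            exact ⟨X (⟨i, j⟩ : Y), by simp [y]⟩
    intro f
    obtain ⟨n, a, ha, rfl⟩ := h𝒜.exists_sum f
    exact Subalgebra.sum_mem _ fun i _ => hle i (ha i)
  · intro n c hc hlow
    rcases n with _ | n
    · ext j
      by_contra h
      exact Nat.succ_ne_zero _ (hc j (Finsupp.mem_support_iff.mpr h))
    set φ : Module.Basis.ofVectorSpaceIndex K (C (n + 1)) → Y := fun j => ⟨n, j⟩ with hφ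
    have hφi : Function.Injective φ := fun a b h => eq_of_heq (Sigma.mk.inj h).2
    have hcr : ∀ j ∈ c.support, j ∈ Set.range φ := by
      rintro ⟨i, j⟩ hj
      obtain rfl : i = n := Nat.succ_injective (hc _ hj)
      exact ⟨j, rfl⟩
    set c' := c.comapDomain φ hφi.injOn
    have hcc : c = c'.mapDomain φ := (Finsupp.mapDomain_comapDomain φ hφi c hcr).symm
    have hsum : (c.sum fun j a => a • y j) =
        ((c'.sum fun j a => a • b (n + 1) j : C (n + 1)) : S) := by
      rw [hcc, Finsupp.sum_mapDomain_index (by simp) (fun _ _ _ => add_smul _ _ _)]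
      simp [Finsupp.sum, y, hφ]
    rw [hsum] at hlow
    have h0 : ((c'.sum fun j a => a • b (n + 1) j : C (n + 1)) : S) ∈ (⊥ : Submodule K S) := by
      rw [← hC₁ (n + 1)]
      exact ⟨⟨hCA _ (Submodule.coe_mem _), hlow⟩, Submodule.coe_mem _⟩
    have h1 : (c'.sum fun j a => a • b (n + 1) j : C (n + 1)) = 0 := Subtype.ext (by simpa using h0)
    have h2 : c' = 0 := linearIndependent_iff.mp (b (n + 1)).linearIndependent c'
      (by rw [Finsupp.linearCombination_apply]; exact h1)
    rw [hcc, h2, Finsupp.mapDomain_zero]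

end IsConnectedGrading

end

section

open MvPolynomial

theorem exists_root_or_pderiv_ne_zero {K Y : Type*} [Field K]
    (hK : ∀ p : ℕ, p ≠ 0 → ∀ a : K, ∃ b, b ^ p = a) {e : Y → ℕ} {n : ℕ}
    (hn : 0 < n) {P : MvPolynomial Y K} (hP : IsWeightedHomogeneous e P n) :
    (∃ j, pderiv j P ≠ 0) ∨
      ∃ (G : MvPolynomial Y K) (p : ℕ), G ^ p = P ∧ WeightLT e n G := by
  classical
  by_contra! hcon
  obtain ⟨hd, hG⟩ := hcon
  have hcoef : ∀ m ∈ P.support, ∀ j, ((m j : ℕ) : K) = 0 := by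
    intro m hm j
    by_cases hj : m j = 0
    · simp [hj]
    have h := congrArg (coeff (m - Finsupp.single j 1)) (hd j)
    rw [coeff_pderiv, coeff_zero] at h
    have hm' : m - Finsupp.single j 1 + Finsupp.single j 1 = m := by
      ext i
      by_cases hi : i = j
      · subst hi; simp; omega
      · simp [Ne.symm hi]
    rw [hm'] at h
    rcases mul_eq_zero.mp h with h | h
    · exact (mem_support_iff.mp hm h).elim
    · rw [← h]
      have : (m - Finsupp.single j 1 : Y →₀ ℕ) j + 1 = m j := by simp; omega
      exact_mod_cast congrArg (Nat.cast (R := K)) this.symm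
  obtain ⟨p, hp⟩ := CharP.exists K
  have hdvd : ∀ m ∈ P.support, ∀ j, p ∣ m j := fun m hm j =>
    (CharP.cast_eq_zero_iff K p _).mp (hcoef m hm j)
  rcases CharP.char_is_prime_or_zero K p with hpp | hp0
  · have := Fact.mk hpp
    choose r hr using hK p hpp.ne_zero
    refine hG (∑ m ∈ P.support, monomial (m.mapRange (· / p) (by simp)) (r (coeff m P))) p ?_ ?_
    · rw [sum_pow_char]
      conv_rhs => rw [P.as_sum]
      refine Finset.sum_congr rfl fun m hm => ?_
      rw [monomial_pow, hr]
      congr 2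
      ext j
      simpa using Nat.mul_div_cancel' (hdvd m hm j)
    · refine WeightLT.sum fun m hm => ?_
      refine WeightLT.of_isWeightedHomogeneous (isWeightedHomogeneous_monomial _ _ _ rfl) ?_
      have h1 : p • m.mapRange (· / p) (by simp) = m := by
        ext j
        simpa using Nat.mul_div_cancel' (hdvd m hm j)
      have h2 := hP (mem_support_iff.mp hm)
      rw [← h1, map_nsmul, smul_eq_mul] at h2
      have h3 := hpp.two_le
      have h4 : 0 < Finsupp.weight e (m.mapRange (· / p) (by simp)) :=
        Nat.pos_of_ne_zero fun h => by rw [h] at h2; omega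
      nlinarith
  · refine hG P 1 (pow_one _) fun m hm => ?_
    have : m = 0 := by
      ext j
      have := hdvd m (mem_support_iff.mpr hm) j
      rw [hp0] at this
      simpa using this
    rw [this, map_zero]; exact hn

namespace IsConnectedGrading


variable {K V Y : Type*} {S : Type v} [Field K] [CommRing S] [Algebra K S]
  {𝒜 : ℕ → Submodule K S}

/-- A weighted homogeneous polynomial with a nonzero linear term is not a relation among minimal
generators. -/
theorem coeff_single_eq_zero {e : Y → ℕ} {y : Y → S} (he : ∀ j, 0 < e j)
    (hy : ∀ j, y j ∈ 𝒜 (e j))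
    (hind : ∀ (n : ℕ) (c : Y →₀ K), (∀ j ∈ c.support, e j = n) →
      (c.sum fun j a => a • y j) ∈ lowSubalgebra 𝒜 n → c = 0)
    {n : ℕ} {P : MvPolynomial Y K} (hP : IsWeightedHomogeneous e P n) (h0 : aeval y P = 0)
    (j : Y) : coeff (Finsupp.single j 1) P = 0 := by
  classical
  rcases Nat.eq_zero_or_pos n with rfl | hn
  · by_contra h
    have := hP h
    simp [Finsupp.weight_apply] at this
    exact (he j).ne' this
  let c : Y →₀ K := Finsupp.onFinset P.vars (fun j => coeff (Finsupp.single j 1) P) fun i hi => by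
    rw [mem_vars_iff_mem_support]
    exact ⟨_, mem_support_iff.mpr hi, by simp⟩
  let Q : MvPolynomial Y K := c.sum fun i a => C a * X i
  have hQc : ∀ m, coeff m Q = if ∃ i, m = Finsupp.single i 1 then coeff m P else 0 := by
    intro m
    simp only [Q, Finsupp.sum, coeff_sum, coeff_C_mul, coeff_X]
    split_ifs with h
    · obtain ⟨i, rfl⟩ := h
      rw [Finset.sum_eq_single i]
      · simp [c]
      · intro l _ hl
        rw [if_neg, mul_zero]
        intro h
        exact hl (Finsupp.single_left_injective one_ne_zero h)
      · intro hi
        simp [Finsupp.notMem_support_iff.mp hi]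
    · refine Finset.sum_eq_zero fun i _ => ?_
      rw [if_neg fun hh => h ⟨i, hh.symm⟩, mul_zero]
  have hce : ∀ i ∈ c.support, e i = n := by
    intro i hi
    have h' : c i ≠ 0 := Finsupp.mem_support_iff.mp hi
    have := hP (show coeff (Finsupp.single i 1) P ≠ 0 from h')
    simpa [Finsupp.weight_apply] using this
  have hvars : P - Q ∈ supported K {i | e i < n} := by
    rw [mem_supported]
    intro i hi
    obtain ⟨m, hm, him⟩ := (mem_vars_iff_mem_support i).mp hi
    rw [mem_support_iff, coeff_sub, hQc] at hm
    split_ifs at hm with h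
    · simp at hm
    rw [sub_zero] at hm
    have hw := hP hm
    have h1 : m = (m - Finsupp.single i 1) + Finsupp.single i 1 := by
      ext l
      by_cases hl : l = i
      · subst hl
        have := Finsupp.mem_support_iff.mp him
        simp; omega
      · simp [Ne.symm hl]
    have h2 : m - Finsupp.single i 1 ≠ 0 := fun h0 => h ⟨i, by rw [h1, h0, zero_add]⟩
    obtain ⟨l, hl⟩ := Finsupp.support_nonempty_iff.mpr h2
    have h3 : e l ≤ Finsupp.weight e (m - Finsupp.single i 1) :=
      Finsupp.le_weight_of_ne_zero' (w := e) (Finsupp.mem_support_iff.mp hl)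
    rw [h1, map_add] at hw
    simp [Finsupp.weight_apply] at hw h3
    have := he l
    simp only [Set.mem_ofPred_eq]
    omega
  have hlow : aeval y (P - Q) ∈ lowSubalgebra 𝒜 n := by
    rw [supported_eq_adjoin_X] at hvars
    generalize P - Q = F at hvars ⊢
    induction hvars using Algebra.adjoin_induction with
    | mem x hx =>
      obtain ⟨i, hi, rfl⟩ := hx
      rw [aeval_X]
      exact Algebra.subset_adjoin (Set.mem_biUnion hi (hy i))
    | algebraMap r => simp
    | add x y _ _ hx hy => rw [map_add]; exact Subalgebra.add_mem _ hx hy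
    | mul x y _ _ hx hy => rw [map_mul]; exact Subalgebra.mul_mem _ hx hy
  have hQ : aeval y Q = c.sum fun i a => a • y i := by
    simp [Q, Finsupp.sum, Algebra.smul_def]
  rw [map_sub, h0, zero_sub, hQ] at hlow
  have hc := hind n c hce (by simpa using Subalgebra.neg_mem _ hlow)
  exact DFunLike.congr_fun hc j

variable (h𝒜 : IsConnectedGrading 𝒜)

include h𝒜

theorem eq_zero_of_aeval_eq_zero [Nontrivial S] [IsReduced S]
    (hK : ∀ p : ℕ, p ≠ 0 → ∀ a : K, ∃ b, b ^ p = a)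
    (τ : V → S →ₐ[K] S)
    (hτ : ∀ u i f, f ∈ 𝒜 i → ∃ a : ℕ → S, (∀ l, a l ∈ 𝒜 l) ∧
      τ u f = f + ∑ l ∈ Finset.range i, a l)
    (hinv : ∀ f, (∀ u, τ u f = f) → ∃ c, algebraMap K S c = f)
    {e : Y → ℕ} {y : Y → S} (he : ∀ j, 0 < e j) (hy : ∀ j, y j ∈ 𝒜 (e j))
    (hsurj : Function.Surjective (aeval (R := K) y))
    (hind : ∀ (n : ℕ) (c : Y →₀ K), (∀ j ∈ c.support, e j = n) →
      (c.sum fun j a => a • y j) ∈ lowSubalgebra 𝒜 n → c = 0)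
    (n : ℕ) : ∀ P : MvPolynomial Y K, IsWeightedHomogeneous e P n → aeval y P = 0 → P = 0 := by
  classical
  induction n using Nat.strong_induction_on with
  | _ n ih =>
  intro P hP h0
  have hlow : ∀ Q, WeightLT e n Q → aeval y Q = 0 → Q = 0 := fun Q hQ hQ0 =>
    h𝒜.eq_zero_of_weightLT hy (fun i hi P hP => ih i hi P hP) hQ hQ0
  rcases Nat.eq_zero_or_pos n with rfl | hn
  · have hPC : P = C (coeff 0 P) := by
      rw [← weightedHomogeneousComponent_zero _ fun j => (he j).ne',
        weightedHomogeneousComponent_eq_self hP]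
    rw [hPC, algHom_C] at h0
    rw [hPC, (map_eq_zero_iff _ (algebraMap K S).injective).mp h0, C_0]
  by_contra hP0
  have hqs : ∀ u j, ∃ q : MvPolynomial Y K, WeightLT e (e j) q ∧ aeval y q = τ u (y j) - y j := by
    intro u j
    obtain ⟨a, ha, hau⟩ := hτ u _ _ (hy j)
    choose F hF using fun l => hsurj (a l)
    refine ⟨∑ l ∈ Finset.range (e j), weightedHomogeneousComponent e l (F l),
      WeightLT.sum fun l hl => WeightLT.of_isWeightedHomogeneous
        (weightedHomogeneousComponent_isWeightedHomogeneous _ _) (Finset.mem_range.mp hl), ?_⟩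
    rw [hau, map_sum, add_sub_cancel_left]
    refine Finset.sum_congr rfl fun l _ => ?_
    rw [h𝒜.exists_homogeneous_lift hy (by rw [hF]; exact ha l), hF]
  choose q hq hqy using hqs
  let T : V → MvPolynomial Y K →ₐ[K] MvPolynomial Y K := fun u => aeval fun j => X j + q u j
  have hT : ∀ u Q, aeval y (T u Q) = τ u (aeval y Q) := by
    intro u Q
    have : (aeval y).comp (T u) = (τ u).comp (aeval y) := algHom_ext fun j => by
      simp [T, hqy]
    exact DFunLike.congr_fun this Q
  have hTP : ∀ u, T u P = P := fun u => sub_eq_zero.mp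
    (hlow _ (WeightLT.aeval_sub (hq u) hP)
      (by rw [map_sub]; change aeval y (T u P) - _ = 0; rw [hT, h0, map_zero, sub_zero]))
  rcases exists_root_or_pderiv_ne_zero hK hn hP with ⟨j₁, hj₁⟩ | ⟨G, p, hGp, hG⟩
  · have hmem : ∀ j, pderiv j P ≠ 0 → j ∈ P.vars := fun j hj => by
      by_contra h; exact hj (pderiv_eq_zero_of_notMem_vars h)
    obtain ⟨j, hj, hmax⟩ := (P.vars.filter fun j => pderiv j P ≠ 0).exists_max_image e
      ⟨j₁, Finset.mem_filter.mpr ⟨hmem _ hj₁, hj₁⟩⟩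
    rw [Finset.mem_filter] at hj
    have hq0 : ∀ u i, e i ≤ e j → pderiv j (q u i) = 0 := by
      intro u i hij
      refine pderiv_eq_zero_of_notMem_vars fun h => ?_
      obtain ⟨m, hm, hjm⟩ := (mem_vars_iff_mem_support j).mp h
      have h1 := hq u i m (mem_support_iff.mp hm)
      have h2 := Finsupp.le_weight_of_ne_zero' (w := e) (Finsupp.mem_support_iff.mp hjm)
      omega
    have hinvd : ∀ u, T u (pderiv j P) = pderiv j P := by
      intro u
      conv_rhs => rw [← hTP u]
      rw [pderiv_aeval_of_vars_subset _ j (T := P.vars) subset_rfl, Finset.sum_eq_single j]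
      · rw [map_add, pderiv_X_self, hq0 u j le_rfl, add_zero, mul_one]
      · intro i hi hij
        by_cases h : pderiv i P = 0
        · rw [h, map_zero, zero_mul]
        · rw [map_add, pderiv_X_of_ne hij, hq0 u i (hmax i (Finset.mem_filter.mpr ⟨hi, h⟩)),
            add_zero, mul_zero]
      · exact fun h => (h hj.1).elim
    obtain ⟨c, hc⟩ := hinv (aeval y (pderiv j P)) fun u => by rw [← hT, hinvd]
    have hwd : WeightLT e n (pderiv j P) := by
      intro m hm
      rw [coeff_pderiv] at hm
      have := hP (left_ne_zero_of_mul hm)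
      have hj := he j
      rw [map_add, Finsupp.weight_single, smul_eq_mul, one_mul] at this
      omega
    have hdc : pderiv j P = C c := sub_eq_zero.mp (hlow _ (hwd.sub
      (WeightLT.of_isWeightedHomogeneous (isWeightedHomogeneous_C _ _) hn))
      (by rw [map_sub, algHom_C, hc, sub_self]))
    have h5 := coeff_single_eq_zero he hy hind hP h0 j
    have h6 := congrArg (coeff 0) hdc
    rw [coeff_pderiv, zero_add, h5, zero_mul, coeff_zero_C] at h6
    rw [← h6, C_0] at hdc
    exact hj.2 hdc
  · rw [← hGp, map_pow] at h0
    rcases p with _ | p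
    · simp at h0
    · rw [hlow G hG (IsReduced.eq_zero _ ⟨_, h0⟩), zero_pow p.succ_ne_zero] at hGp
      exact hP0 hGp.symm

/-- An algebra graded by `ℕ` with sufficiently many "translations" is a polynomial algebra on
homogeneous generators. -/
theorem exists_bijective_aeval [Nontrivial S] [IsReduced S]
    (hK : ∀ p : ℕ, p ≠ 0 → ∀ a : K, ∃ b, b ^ p = a)
    (τ : V → S →ₐ[K] S)
    (hτ : ∀ u i f, f ∈ 𝒜 i → ∃ a : ℕ → S, (∀ l, a l ∈ 𝒜 l) ∧
      τ u f = f + ∑ l ∈ Finset.range i, a l)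
    (hinv : ∀ f, (∀ u, τ u f = f) → ∃ c, algebraMap K S c = f) :
    ∃ (Y : Type v) (e : Y → ℕ) (y : Y → S), (∀ j, 0 < e j) ∧ (∀ j, y j ∈ 𝒜 (e j)) ∧
      Function.Bijective (aeval (R := K) y) := by
  obtain ⟨Y, e, y, he, hy, hsurj, hind⟩ := h𝒜.exists_generators
  refine ⟨Y, e, y, he, hy, (injective_iff_map_eq_zero _).mpr fun Q hQ => ?_, hsurj⟩
  have hcomp : ∀ i, weightedHomogeneousComponent e i Q = 0 := fun i =>
    h𝒜.eq_zero_of_aeval_eq_zero hK τ hτ hinv he hy hsurj hind i _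
      (weightedHomogeneousComponent_isWeightedHomogeneous i Q) (by
        rw [h𝒜.exists_homogeneous_lift hy (by rw [hQ]; exact Submodule.zero_mem _), hQ])
  obtain ⟨n, hn⟩ := exists_eq_sum_range_weightedHomogeneousComponent e Q
  rw [hn]; simp [hcomp]

end IsConnectedGrading

end

section

open MvPolynomial

/-- Over a flat algebra, a nonzerodivisor modulo an ideal remains a nonzerodivisor. -/
theorem Module.Flat.mem_span_range_of_mul_mem {A S κ : Type*} [CommRing A] [CommRing S]
    [Algebra A S] [Module.Flat A S] [Finite κ] {g : κ → A} {x : A}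
    (hx : ∀ a, x * a ∈ Ideal.span (Set.range g) → a ∈ Ideal.span (Set.range g)) {s : S}
    (hs : algebraMap A S x * s ∈ Ideal.span (Set.range fun l => algebraMap A S (g l))) :
    s ∈ Ideal.span (Set.range fun l => algebraMap A S (g l)) := by
  have := Fintype.ofFinite κ
  rw [Ideal.mem_span_range_iff_exists_fun] at hs
  obtain ⟨c, hc⟩ := hs
  have hrel : ∑ l : Option κ, (l.elim x g : A) • (l.elim s fun l => - c l : S) = 0 := by
    simp only [Fintype.sum_option, Option.elim_none, Option.elim_some, Algebra.smul_def, mul_neg,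
      Finset.sum_neg_distrib, ← hc]
    simp [mul_comm]
  obtain ⟨k, a, u, hau, ha⟩ :=
    Module.Flat.isTrivialRelation_of_sum_smul_eq_zero (R := A) (M := S) hrel
  have h0 := hau none
  simp only [Option.elim_none, Algebra.smul_def] at h0
  rw [h0]
  refine Ideal.sum_mem _ fun t _ => Ideal.mul_mem_right _ _ ?_
  have h1 : a none t ∈ Ideal.span (Set.range g) := by
    refine hx _ ?_
    have h2 := ha t
    simp only [Fintype.sum_option, Option.elim_none, Option.elim_some] at h2
    rw [eq_neg_of_add_eq_zero_left h2]
    exact Submodule.neg_mem _ (Ideal.sum_mem _ fun l _ => Ideal.mul_mem_right _ _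
      (Ideal.subset_span ⟨l, rfl⟩))
  have h3 := Ideal.mem_map_of_mem (algebraMap A S) h1
  rw [Ideal.map_span, ← Set.range_comp] at h3
  exact h3

namespace MvPolynomial

variable {K σ ι : Type*} [Field K]

/-- The graded Nakayama lemma. -/
theorem span_eq_top_of_sup_span_eq_top [Finite ι] {w : ι → MvPolynomial σ K} {d : ι → ℕ}
    (hw : ∀ l, (w l).IsHomogeneous (d l)) (hd : ∀ l, 0 < d l) {T : Set (MvPolynomial σ K)}
    (hT : ∀ t ∈ T, ∃ n, t.IsHomogeneous n)
    (hwT : ∀ l, ∀ t ∈ T, t * w l ∈ Submodule.span K T)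
    (htop : ∀ f, ∃ v ∈ Submodule.span K T, f - v ∈ Ideal.span (Set.range w)) :
    Submodule.span K T = ⊤ := by
  classical
  have := Fintype.ofFinite ι
  have hmul : ∀ l, ∀ t ∈ Submodule.span K T, t * w l ∈ Submodule.span K T := by
    intro l t ht
    induction ht using Submodule.span_induction with
    | mem t ht => exact hwT l t ht
    | zero => simp
    | add a b _ _ ha hb => rw [add_mul]; exact Submodule.add_mem _ ha hb
    | smul c a _ ha => rw [smul_mul_assoc]; exact Submodule.smul_mem _ c ha
  have hcomp : ∀ n, ∀ t ∈ Submodule.span K T, homogeneousComponent n t ∈ Submodule.span K T := by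
    intro n t ht
    induction ht using Submodule.span_induction with
    | mem t ht =>
      obtain ⟨m, hm⟩ := hT t ht
      rw [homogeneousComponent_of_mem hm]
      split_ifs
      · exact Submodule.subset_span ht
      · exact Submodule.zero_mem _
    | zero => simp
    | add a b _ _ ha hb => rw [map_add]; exact Submodule.add_mem _ ha hb
    | smul c a _ ha => rw [map_smul]; exact Submodule.smul_mem _ c ha
  have hhom : ∀ n, ∀ f : MvPolynomial σ K, f.IsHomogeneous n → f ∈ Submodule.span K T := by
    intro n
    induction n using Nat.strong_induction_on with
    | _ n ih =>
    intro f hf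
    obtain ⟨v, hv, hfv⟩ := htop f
    obtain ⟨c, hc⟩ := (Ideal.mem_span_range_iff_exists_fun).mp hfv
    have h1 : f = homogeneousComponent n v + ∑ l, homogeneousComponent n (c l * w l) := by
      rw [← map_sum, hc, ← map_add, add_sub_cancel, homogeneousComponent_eq_self hf]
    rw [h1]
    refine Submodule.add_mem _ (hcomp n v hv) (Submodule.sum_mem _ fun l _ => ?_)
    rw [← sum_homogeneousComponent (c l), Finset.sum_mul, map_sum]
    refine Submodule.sum_mem _ fun i _ => ?_
    rw [homogeneousComponent_of_mem ((homogeneousComponent_isHomogeneous i (c l)).mul (hw l))]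
    split_ifs with h
    · exact hmul l _ (ih i (by have := hd l; omega) _ (homogeneousComponent_isHomogeneous i _))
    · exact Submodule.zero_mem _
  refine eq_top_iff.mpr fun f _ => ?_
  rw [← sum_homogeneousComponent f]
  exact Submodule.sum_mem _ fun i _ => hhom i _ (homogeneousComponent_isHomogeneous i _)

theorem X_mul_mem_span_image_X {J : Set ι} {i : ι} (hi : i ∉ J) {a : MvPolynomial ι K}
    (h : X i * a ∈ Ideal.span (X '' J)) : a ∈ Ideal.span (X '' J) := by
  classical
  rw [mem_ideal_span_X_image] at h ⊢
  intro m hm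
  obtain ⟨j, hj, hmj⟩ := h (m + Finsupp.single i 1) (by
    rw [mem_support_iff, mul_comm, coeff_mul_X]; exact mem_support_iff.mp hm)
  refine ⟨j, hj, ?_⟩
  have : i ≠ j := fun h => hi (h ▸ hj)
  simpa [Finsupp.single_apply, this] using hmj

/-- Over a flat algebra, the image of a variable is a nonzerodivisor modulo other variables. -/
theorem mem_span_image_of_flat [Finite ι] {S : Type*} [CommRing S] [Algebra K S] {w : ι → S}
    (hflat : (aeval (R := K) w).toRingHom.Flat) {J : Set ι} {i : ι} (hi : i ∉ J) {s : S}
    (hs : w i * s ∈ Ideal.span (w '' J)) : s ∈ Ideal.span (w '' J) := by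
  obtain ⟨f, hf, hflat⟩ : ∃ f : MvPolynomial ι K →+* S, (∀ l, f (X l) = w l) ∧ f.Flat :=
    ⟨_, fun l => aeval_X w l, hflat⟩
  let _ : Algebra (MvPolynomial ι K) S := f.toAlgebra
  have : Module.Flat (MvPolynomial ι K) S := hflat
  have hf' : ∀ l, algebraMap (MvPolynomial ι K) S (X l) = w l := hf
  have key := Module.Flat.mem_span_range_of_mul_mem (A := MvPolynomial ι K)
    (g := fun l : J => X (l : ι)) (x := X i) (s := s) (fun a ha => by
      rw [← Set.image_eq_range] at ha ⊢
      exact X_mul_mem_span_image_X hi ha)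
  simp only [hf', ← Set.image_eq_range] at key
  exact key hs

end MvPolynomial

/-- The Cayley-Hamilton theorem modulo an ideal. -/
theorem exists_monic_eval₂_mem {A S ι : Type*} [CommRing A] [Nontrivial A] [CommRing S] [Fintype ι]
    (f : A →+* S) (I : Ideal S) (G : ι → S) (hG : ∀ s, ∃ c : ι → A, s - ∑ a, f (c a) * G a ∈ I)
    (y : S) : ∃ p : Polynomial A, p.Monic ∧ p.natDegree ≤ Fintype.card ι ∧ p.eval₂ f y ∈ I := by
  let _ : Algebra A S := f.toAlgebra
  have hspan : Submodule.span A (Set.range fun a => Ideal.Quotient.mk I (G a)) = ⊤ := by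
    refine eq_top_iff.mpr fun s _ => ?_
    obtain ⟨s, rfl⟩ := Ideal.Quotient.mk_surjective s
    obtain ⟨c, hc⟩ := hG s
    rw [Submodule.mem_span_range_iff_exists_fun]
    refine ⟨c, ?_⟩
    rw [← Ideal.Quotient.eq] at hc
    rw [hc, map_sum]
    refine Finset.sum_congr rfl fun a _ => ?_
    rw [map_mul, Algebra.smul_def]
    rfl
  have : Module.Finite A (S ⧸ I) := ⟨⟨(Set.finite_range _).toFinset, by simpa using hspan⟩⟩
  obtain ⟨p, hp, hdeg, hp0⟩ := LinearMap.exists_monic_and_natDegree_eq_and_aeval_eq_zero A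
    (Algebra.lmul A (S ⧸ I) (Ideal.Quotient.mk I y))
  refine ⟨p, hp, ?_, ?_⟩
  · rw [hdeg, ← hspan]
    refine (Submodule.spanFinrank_span_le_ncard_of_finite (Set.finite_range _)).trans ?_
    rw [← Nat.card_eq_fintype_card, ← Set.ncard_univ, ← Set.image_univ]
    exact Set.ncard_image_le
  · rw [Polynomial.aeval_algHom_apply] at hp0
    have h1 := LinearMap.congr_fun hp0 1
    simp only [Algebra.coe_lmul_eq_mul, LinearMap.mul_apply', mul_one, LinearMap.zero_apply] at h1
    rw [← Ideal.Quotient.eq_zero_iff_mem, ← h1, Polynomial.aeval_def, Polynomial.hom_eval₂]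
    rfl

end

section

open MvPolynomial

namespace MvPolynomial

theorem aeval_finSuccEquiv_symm {K S : Type*} [CommRing K] [CommRing S] [Algebra K S] {n : ℕ}
    (w : Fin (n + 1) → S) (p : Polynomial (MvPolynomial (Fin n) K)) :
    aeval w ((finSuccEquiv K n).symm p) =
      p.eval₂ (aeval (R := K) fun l : Fin n => w l.succ).toRingHom (w 0) := by
  obtain ⟨q, rfl⟩ := (finSuccEquiv K n).surjective p
  rw [AlgEquiv.symm_apply_apply]
  induction q using MvPolynomial.induction_on with
  | C a => simp [finSuccEquiv_apply]
  | add p q hp hq => simp only [map_add, hp, hq, Polynomial.eval₂_add]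
  | mul_X p i hp =>
    rw [map_mul, hp, aeval_X, map_mul, Polynomial.eval₂_mul]
    congr 1
    refine Fin.cases ?_ (fun i => ?_) i
    · simp [finSuccEquiv_X_zero]
    · simp [finSuccEquiv_X_succ]

/-- A regular sequence is quasi-regular: elements independent modulo the sequence are independent
over the polynomial ring generated by it. -/
theorem eq_zero_of_sum_aeval_mul_mem {K S α : Type*} [Field K] [CommRing S] [Algebra K S]
    {c : α → S} {n : ℕ} : ∀ (w : Fin n → S) (J : Ideal S)
    (_ : ∀ j s, w j * s ∈ J ⊔ Ideal.span (w '' {l | l < j}) → s ∈ J ⊔ Ideal.span (w '' {l | l < j}))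
    (_ : ∀ (t : Finset α) (a : α → K), ∑ i ∈ t, algebraMap K S (a i) * c i ∈
      J ⊔ Ideal.span (Set.range w) → ∀ i ∈ t, a i = 0)
    (t : Finset α) (P : α → MvPolynomial (Fin n) K), ∑ i ∈ t, aeval w (P i) * c i ∈ J →
      ∀ i ∈ t, P i = 0 := by
  induction n with
  | zero =>
    intro w J _ hc t P hP i hi
    have h := hc t (fun i => coeff 0 (P i)) (by
      refine Submodule.mem_sup_left ?_
      convert! hP using 3 with i
      conv_rhs => rw [eq_C_of_isEmpty (P i), algHom_C]) i hi
    rw [eq_C_of_isEmpty (P i), h, C_0]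
  | succ n ih =>
    intro w J hreg hc
    have himg : ∀ j : Fin n, (J ⊔ Ideal.span {w 0}) ⊔
        Ideal.span ((fun l : Fin n => w l.succ) '' {l | l < j}) =
        J ⊔ Ideal.span (w '' {l | l < j.succ}) := by
      intro j
      have : w '' {l | l < j.succ} = insert (w 0) ((fun l : Fin n => w l.succ) '' {l | l < j}) := by
        ext x
        constructor
        · rintro ⟨l, hl, rfl⟩
          refine Fin.cases (fun _ => Or.inl rfl) (fun l hl => Or.inr ⟨l, ?_, rfl⟩) l hl
          exact Fin.succ_lt_succ_iff.mp hl
        · rintro (rfl | ⟨l, hl, rfl⟩)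
          · exact ⟨0, Fin.succ_pos j, rfl⟩
          · exact ⟨l.succ, Fin.succ_lt_succ_iff.mpr hl, rfl⟩
      rw [this, Ideal.span_insert, sup_assoc]
    have hrange : (J ⊔ Ideal.span {w 0}) ⊔ Ideal.span (Set.range fun l : Fin n => w l.succ) =
        J ⊔ Ideal.span (Set.range w) := by
      have : Set.range w = insert (w 0) (Set.range fun l : Fin n => w l.succ) := by
        ext x
        constructor
        · rintro ⟨l, rfl⟩
          exact Fin.cases (Or.inl rfl) (fun l => Or.inr ⟨l, rfl⟩) l
        · rintro (rfl | ⟨l, rfl⟩) <;> exact ⟨_, rfl⟩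
      rw [this, Ideal.span_insert, sup_assoc]
    have ih' := ih (fun l => w l.succ) (J ⊔ Ideal.span {w 0})
      (fun j s => by rw [himg]; exact hreg j.succ s)
      (fun t a => by rw [hrange]; exact hc t a)
    have hreg0 : ∀ s, w 0 * s ∈ J → s ∈ J := by
      intro s hs
      have : w '' {l | l < 0} = ∅ := by simp
      have h := hreg 0 s
      rw [this, Ideal.span_empty, sup_bot_eq] at h
      exact h hs
    have key : ∀ (T : ℕ) (t : Finset α) (p : α → Polynomial (MvPolynomial (Fin n) K)),
        (∀ i ∈ t, ∀ m, T ≤ m → (p i).coeff m = 0) →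
        ∑ i ∈ t, (p i).eval₂ (aeval (R := K) fun l : Fin n => w l.succ).toRingHom (w 0) * c i ∈ J →
        ∀ i ∈ t, p i = 0 := by
      intro T
      induction T with
      | zero => exact fun t p hp _ i hi => Polynomial.ext fun m => hp i hi m (Nat.zero_le _)
      | succ T ihT =>
        intro t p hp hJ
        have hexp : ∀ i, (p i).eval₂ (aeval (R := K) fun l : Fin n => w l.succ).toRingHom (w 0) =
            w 0 * (p i).divX.eval₂ (aeval (R := K) fun l : Fin n => w l.succ).toRingHom (w 0) +
              aeval (fun l : Fin n => w l.succ) ((p i).coeff 0) := by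
          intro i
          conv_lhs => rw [← Polynomial.divX_mul_X_add (p i)]
          rw [Polynomial.eval₂_add, Polynomial.eval₂_mul, Polynomial.eval₂_X, Polynomial.eval₂_C,
            mul_comm]
          rfl
        have hsum : ∑ i ∈ t, (p i).eval₂ (aeval (R := K) fun l : Fin n => w l.succ).toRingHom (w 0)
            * c i = w 0 * ∑ i ∈ t, (p i).divX.eval₂
              (aeval (R := K) fun l : Fin n => w l.succ).toRingHom (w 0) * c i +
              ∑ i ∈ t, aeval (fun l : Fin n => w l.succ) ((p i).coeff 0) * c i := by
          rw [Finset.mul_sum, ← Finset.sum_add_distrib]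
          exact Finset.sum_congr rfl fun i _ => by rw [hexp]; ring
        have h0 := ih' t (fun i => (p i).coeff 0) (by
          rw [← (add_sub_cancel_left _ _ :
            _ + ∑ i ∈ t, aeval (fun l : Fin n => w l.succ) ((p i).coeff 0) * c i - _ = _), ← hsum]
          exact Submodule.sub_mem _ (Submodule.mem_sup_left hJ) (Submodule.mem_sup_right
            (Ideal.mul_mem_right _ _ (Ideal.subset_span rfl))))
        have hz : ∑ i ∈ t, aeval (fun l : Fin n => w l.succ) ((p i).coeff 0) * c i = 0 :=
          Finset.sum_eq_zero fun i hi => by rw [h0 i hi, map_zero, zero_mul]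
        rw [hsum, hz, add_zero] at hJ
        have h1 := ihT t (fun i => (p i).divX) (fun i hi m hm => by
          rw [Polynomial.coeff_divX]; exact hp i hi _ (by omega)) (hreg0 _ hJ)
        intro i hi
        have h2 := h1 i hi
        have h3 := h0 i hi
        rw [← Polynomial.divX_mul_X_add (p i)]
        rw [h2, h3, zero_mul, map_zero, zero_add]
    intro t P hP i hi
    have h := key (t.sup fun i => (finSuccEquiv K n (P i)).natDegree + 1) t
      (fun i => finSuccEquiv K n (P i))
      (fun i hi m hm => Polynomial.coeff_eq_zero_of_natDegree_lt
        ((Finset.le_sup (f := fun i => (finSuccEquiv K n (P i)).natDegree + 1) hi).trans hm))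
      (by simpa only [← aeval_finSuccEquiv_symm, AlgEquiv.symm_apply_apply] using hP) i hi
    exact (map_eq_zero_iff _ (finSuccEquiv K n).injective).mp h

/-- Homogeneous regular sequences are flat. -/
theorem flat_aeval_of_regular {K σ : Type*} [Field K] {n : ℕ} {w : Fin n → MvPolynomial σ K}
    {d : Fin n → ℕ} (hw : ∀ l, (w l).IsHomogeneous (d l)) (hd : ∀ l, 0 < d l)
    (hreg : ∀ j s, w j * s ∈ Ideal.span (w '' {l | l < j}) → s ∈ Ideal.span (w '' {l | l < j})) :
    (aeval (R := K) w).toRingHom.Flat := by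
  classical
  let I := Ideal.span (Set.range w)
  let π := (Ideal.Quotient.mkₐ K I).toLinearMap
  obtain ⟨κ, a, -, hspan, hli⟩ := exists_linearIndependent' K
    fun m : σ →₀ ℕ => π (monomial m (1 : K))
  let c : κ → MvPolynomial σ K := fun i => monomial (a i) 1
  have hci : LinearIndependent K fun i => π (c i) := hli
  have hind : ∀ (t : Finset κ) (P : κ → MvPolynomial (Fin n) K),
      ∑ i ∈ t, aeval w (P i) * c i = 0 → ∀ i ∈ t, P i = 0 := by
    intro t P h
    refine eq_zero_of_sum_aeval_mul_mem w ⊥ (by simpa using hreg) (fun t b hb => ?_) t P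
      (by simpa using h)
    rw [bot_sup_eq] at hb
    refine linearIndependent_iff'.mp hci t b ?_
    rw [← Ideal.Quotient.eq_zero_iff_mem] at hb
    rw [← hb, map_sum]
    refine Finset.sum_congr rfl fun i _ => ?_
    rw [← Algebra.smul_def]
    exact (map_smul π _ _).symm
  have htop : Submodule.span K (Set.range fun x : κ × (Fin n →₀ ℕ) =>
      c x.1 * aeval w (monomial x.2 (1 : K))) = ⊤ := by
    refine span_eq_top_of_sup_span_eq_top hw hd ?_ ?_ ?_
    · rintro _ ⟨x, rfl⟩
      refine ⟨(a x.1).degree + x.2.sum fun l i => d l * i, (isHomogeneous_monomial _ rfl).mul ?_⟩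
      rw [aeval_monomial, map_one, one_mul]
      exact IsHomogeneous.prod _ _ _ fun l _ => (hw l).pow _
    · rintro l _ ⟨x, rfl⟩
      refine Submodule.subset_span ⟨⟨x.1, x.2 + Finsupp.single l 1⟩, ?_⟩
      simp only
      rw [mul_assoc]
      conv_rhs => rw [← aeval_X (R := K) w l]
      rw [← map_mul, X, monomial_mul, one_mul]
    · intro f
      have hf : π f ∈ Submodule.span K (Set.range fun i => π (c i)) := by
        have : Submodule.span K (Set.range fun i => π (c i)) = Submodule.span K
          (Set.range fun m : σ →₀ ℕ => π (monomial m (1 : K))) := hspan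
        rw [this, f.as_sum, map_sum]
        refine Submodule.sum_mem _ fun m _ => ?_
        rw [← mul_one (coeff m f), ← smul_eq_mul, ← smul_monomial, map_smul]
        exact Submodule.smul_mem _ _ (Submodule.subset_span ⟨m, rfl⟩)
      have : (Set.range fun i => π (c i)) = π '' Set.range c := (Set.range_comp π c)
      rw [this, ← Submodule.map_span] at hf
      obtain ⟨v, hv, hvf⟩ := hf
      refine ⟨v, Submodule.span_mono ?_ hv, Ideal.Quotient.eq.mp hvf.symm⟩
      rintro _ ⟨i, rfl⟩
      exact ⟨⟨i, 0⟩, by simp⟩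
  obtain ⟨f, hf, hfw⟩ : ∃ f : MvPolynomial (Fin n) K →+* MvPolynomial σ K,
      (∀ P, f P = aeval w P) ∧ f = (aeval (R := K) w).toRingHom := ⟨_, fun _ => rfl, rfl⟩
  rw [← hfw]
  let _ : Algebra (MvPolynomial (Fin n) K) (MvPolynomial σ K) := f.toAlgebra
  have hsmul : ∀ (P : MvPolynomial (Fin n) K) (s : MvPolynomial σ K),
      P • s = aeval w P * s := fun P s => by rw [← hf]; rfl
  have hli' : LinearIndependent (MvPolynomial (Fin n) K) c := by
    rw [linearIndependent_iff']
    intro t P h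
    simp only [hsmul] at h
    exact hind t P h
  have hspan' : ⊤ ≤ Submodule.span (MvPolynomial (Fin n) K) (Set.range c) := by
    intro s _
    have hs : s ∈ Submodule.span K (Set.range fun x : κ × (Fin n →₀ ℕ) =>
      c x.1 * aeval w (monomial x.2 (1 : K))) := htop ▸ Submodule.mem_top
    induction hs using Submodule.span_induction with
    | mem s hs =>
      obtain ⟨x, rfl⟩ := hs
      simp only
      rw [mul_comm, ← hsmul]
      exact Submodule.smul_mem _ _ (Submodule.subset_span ⟨_, rfl⟩)
    | zero => exact Submodule.zero_mem _
    | add a b _ _ ha hb => exact Submodule.add_mem _ (ha trivial) (hb trivial)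
    | smul r a _ ha =>
      have : r • a = (C r : MvPolynomial (Fin n) K) • a := by
        rw [hsmul, algHom_C, Algebra.smul_def]
      rw [this]
      exact Submodule.smul_mem _ _ (ha trivial)
  have : Module.Free (MvPolynomial (Fin n) K) (MvPolynomial σ K) :=
    Module.Free.of_basis (Module.Basis.mk hli' hspan')
  change Module.Flat (MvPolynomial (Fin n) K) (MvPolynomial σ K)
  infer_instance

/-- Homogeneous regular sequences indexed by a finite type with a distinguished last element are
flat. -/
theorem flat_aeval_of_regular_last {K σ ι : Type*} [Field K] [Finite ι] {w : ι → MvPolynomial σ K}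
    {d : ι → ℕ} (hw : ∀ l, (w l).IsHomogeneous (d l)) (hd : ∀ l, 0 < d l) (i : ι)
    (hreg : ∀ (J : Set ι) (j : ι), j ∉ J → i ∉ J → j ≠ i → ∀ s, w j * s ∈ Ideal.span (w '' J) →
      s ∈ Ideal.span (w '' J))
    (hlast : ∀ s, w i * s ∈ Ideal.span (w '' {i}ᶜ) → s ∈ Ideal.span (w '' {i}ᶜ)) :
    (aeval (R := K) w).toRingHom.Flat := by
  classical
  have := Fintype.ofFinite ι
  obtain ⟨n, hn⟩ : ∃ n, Fintype.card ι = n + 1 := Nat.exists_eq_succ_of_ne_zero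
    (Fintype.card_pos_iff.mpr ⟨i⟩).ne'
  obtain ⟨e, he⟩ : ∃ e : Fin (n + 1) ≃ ι, e (Fin.last n) = i := by
    let e := (Fintype.equivFinOfCardEq hn).symm
    exact ⟨(Equiv.swap (Fin.last n) (e.symm i)).trans e, by simp⟩
  have himg : ∀ j : Fin (n + 1), (w ∘ e) '' {l | l < j} = w '' (e '' {l | l < j}) := fun j =>
    Set.image_comp _ _ _
  have hflat : (aeval (R := K) (w ∘ e)).toRingHom.Flat := by
    refine flat_aeval_of_regular (d := d ∘ e) (fun l => hw _) (fun l => hd _) fun j s hs => ?_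
    rw [himg] at hs ⊢
    by_cases hj : j = Fin.last n
    · subst hj
      have : e '' {l | l < Fin.last n} = {i}ᶜ := by
        ext l
        rw [← he, Set.mem_compl_iff, Set.mem_singleton_iff]
        constructor
        · rintro ⟨l, hl, rfl⟩ h
          exact hl.ne (e.injective h)
        · intro h
          refine ⟨e.symm l, Fin.lt_last_iff_ne_last.mpr fun hh => h ?_, e.apply_symm_apply l⟩
          rw [← hh, e.apply_symm_apply]
      rw [this] at hs ⊢
      rw [Function.comp_apply, he] at hs
      exact hlast s hs
    · refine hreg _ (e j) ?_ ?_ ?_ s hs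
      · rintro ⟨l, hl, h⟩
        exact hl.ne (e.injective h)
      · rintro ⟨l, hl, h⟩
        rw [← he] at h
        exact (hl.trans_le (Fin.le_last j)).ne (e.injective h)
      · rw [← he]
        exact fun h => hj (e.injective h)
  have hcomp : (aeval (R := K) w).toRingHom =
      (aeval (R := K) (w ∘ e)).toRingHom.comp (renameEquiv K e.symm).toRingEquiv.toRingHom := by
    refine RingHom.ext fun P => ?_
    change aeval w P = aeval (w ∘ e) (rename e.symm P)
    rw [aeval_rename, Function.comp_assoc, Equiv.self_comp_symm, Function.comp_id]
  rw [hcomp]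
  exact RingHom.Flat.comp (RingHom.Flat.of_bijective (renameEquiv K e.symm).bijective) hflat

end MvPolynomial

end

section

open MvPolynomial

namespace MvPolynomial

variable {K σ τ : Type*} [Field K]

theorem aeval_sub_aeval_mem {S : Type*} [CommRing S] [Algebra K S] {I : Ideal S} {v w : σ → S}
    (h : ∀ l, v l - w l ∈ I) (P : MvPolynomial σ K) : aeval v P - aeval w P ∈ I := by
  have : (Ideal.Quotient.mkₐ K I).comp (aeval v) = (Ideal.Quotient.mkₐ K I).comp (aeval w) :=
    algHom_ext fun l => by
      simpa using Ideal.Quotient.eq.mpr (h l)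
  exact Ideal.Quotient.eq.mp (DFunLike.congr_fun this P)

theorem homogeneousComponent_aeval_mul {z : τ → MvPolynomial σ K}
    (hz : ∀ l, (z l).IsHomogeneous 1) {v : MvPolynomial σ K} {m n : ℕ} (hv : v.IsHomogeneous m)
    (hmn : m ≤ n) (c : MvPolynomial τ K) :
    homogeneousComponent n (aeval z c * v) = aeval z (homogeneousComponent (n - m) c) * v := by
  have hc : ∀ i, (aeval z (homogeneousComponent i c) * v).IsHomogeneous (i + m) := fun i => by
    have h := (homogeneousComponent_isHomogeneous i c).aeval z hz
    rw [one_mul] at h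
    exact h.mul hv
  conv_lhs => rw [← sum_homogeneousComponent c, map_sum, Finset.sum_mul, map_sum]
  rw [Finset.sum_eq_single (n - m)]
  · rw [homogeneousComponent_of_mem (hc _), if_pos (by omega)]
  · intro i _ hi
    rw [homogeneousComponent_of_mem (hc _), if_neg (by omega)]
  · intro hi
    have h0 : homogeneousComponent (n - m) c = 0 :=
      homogeneousComponent_eq_zero _ _ (by have := Finset.mem_range.not.mp hi; omega)
    rw [h0, map_zero, zero_mul, map_zero]

/-- Cancelling powers of an element regular up to degree `E`. -/
theorem exists_aeval_mem_of_sum_mem {z : τ → MvPolynomial σ K} (hz : ∀ l, (z l).IsHomogeneous 1)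
    {I : Ideal (MvPolynomial σ K)} {y : MvPolynomial σ K} {e E : ℕ} (hy : y.IsHomogeneous e)
    (hreg : ∀ n ≤ E, ∀ f : MvPolynomial σ K, f.IsHomogeneous n → y * f ∈ I → f ∈ I) (R : ℕ) :
    ∀ h : ℕ → MvPolynomial τ K, (∀ t ≤ R, (h t).IsHomogeneous ((R - t) * e)) → h R = 1 →
      R * e ≤ E → ∑ t ∈ Finset.range (R + 1), aeval z (h t) * y ^ t ∈ I →
      ∃ t ≤ R, h t ≠ 0 ∧ aeval z (h t) ∈ I ⊔ Ideal.span {y} := by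
  induction R with
  | zero =>
    intro h _ h1 _ hI
    refine ⟨0, le_rfl, by rw [h1]; exact one_ne_zero, Submodule.mem_sup_left (by simpa using hI)⟩
  | succ R ih =>
    intro h hh h1 hE hI
    have hsum : ∑ t ∈ Finset.range (R + 1 + 1), aeval z (h t) * y ^ t =
        y * ∑ t ∈ Finset.range (R + 1), aeval z (h (t + 1)) * y ^ t + aeval z (h 0) := by
      rw [Finset.sum_range_succ', Finset.mul_sum, pow_zero, mul_one]
      congr 1
      exact Finset.sum_congr rfl fun t _ => by ring
    rw [hsum] at hI
    by_cases h0 : h 0 = 0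
    · rw [h0, map_zero, add_zero] at hI
      have hE' : R * e ≤ E := le_trans (Nat.mul_le_mul_right _ R.le_succ) hE
      obtain ⟨t, ht, ht0, htI⟩ := ih (fun t => h (t + 1))
        (fun t ht => by simpa using hh (t + 1) (by omega)) h1 hE' (hreg (R * e) hE' _
          (IsHomogeneous.sum _ _ _ fun t ht => by
            have h2 := (hh (t + 1) (by have := Finset.mem_range.mp ht; omega)).aeval z hz
            have h3 := h2.mul (hy.pow t)
            convert! h3 using 1
            have := Finset.mem_range.mp ht
            obtain ⟨u, rfl⟩ : ∃ u, R = t + u := ⟨R - t, by omega⟩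
            rw [show t + u + 1 - (t + 1) = u by omega]
            ring) hI)
      exact ⟨t + 1, by omega, ht0, htI⟩
    · refine ⟨0, by omega, h0, ?_⟩
      rw [← add_sub_cancel_left (y * ∑ t ∈ Finset.range (R + 1), aeval z (h (t + 1)) * y ^ t)
        (aeval z (h 0))]
      exact Submodule.sub_mem _ (Submodule.mem_sup_left hI) (Submodule.mem_sup_right
        (Ideal.mul_mem_right _ _ (Ideal.subset_span rfl)))

/-- `w` is a homogeneous flat system of parameters of the polynomial ring consisting of linear
forms outside `D`, the members in `D` generate `I`, and `G` generates the polynomial ring over the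
subring generated by `w`. -/
structure IsParam {ι : Type} [Fintype ι] (D : Set σ) (w : σ → MvPolynomial σ K)
    (I : Ideal (MvPolynomial σ K)) (G : ι → MvPolynomial σ K) : Prop where
  homogeneous : ∀ l, ∃ d, 0 < d ∧ (w l).IsHomogeneous d
  linear : ∀ l, l ∉ D → (w l).IsHomogeneous 1
  flat : (aeval (R := K) w).toRingHom.Flat
  span_eq : Ideal.span (w '' D) = I
  homogeneous_gen : ∀ a, ∃ n, (G a).IsHomogeneous n
  exists_eq_sum : ∀ f, ∃ P : ι → MvPolynomial σ K, f = ∑ a, aeval w (P a) * G a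

namespace IsParam

variable {ι : Type} [Fintype ι] {D : Set σ} {w : σ → MvPolynomial σ K}
  {I : Ideal (MvPolynomial σ K)} {G : ι → MvPolynomial σ K}

theorem exists_form (hw : IsParam D w I G) {y : MvPolynomial σ K} {e E : ℕ}
    (hy : y.IsHomogeneous e)
    (hreg : ∀ n ≤ E, ∀ f : MvPolynomial σ K, f.IsHomogeneous n → y * f ∈ I → f ∈ I)
    (hE : Fintype.card ι * e ≤ E) :
    ∃ (h : MvPolynomial {l // l ∉ D} K) (s : ℕ), s ≤ Fintype.card ι * e ∧ h ≠ 0 ∧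
      h.IsHomogeneous s ∧ aeval (fun l : {l // l ∉ D} => w l) h ∈ I ⊔ Ideal.span {y} := by
  classical
  let z : {l // l ∉ D} → MvPolynomial σ K := fun l => w l
  have hz : ∀ l, (z l).IsHomogeneous 1 := fun l => hw.linear l l.2
  let kill : MvPolynomial σ K →ₐ[K] MvPolynomial {l // l ∉ D} K :=
    aeval fun l => if h : l ∉ D then X ⟨l, h⟩ else 0
  have hkill : ∀ P, aeval w P - aeval z (kill P) ∈ I := by
    intro P
    have : aeval z (kill P) = aeval (fun l => if l ∉ D then w l else 0) P := by
      rw [← AlgHom.comp_apply]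
      congr 1
      refine algHom_ext fun l => ?_
      by_cases h : l ∈ D <;> simp [kill, z, h]
    rw [this]
    refine aeval_sub_aeval_mem (fun l => ?_) P
    by_cases h : l ∈ D
    · rw [if_neg (by simpa using h), sub_zero, ← hw.span_eq]
      exact Ideal.subset_span ⟨l, h, rfl⟩
    · rw [if_pos h, sub_self]
      exact Submodule.zero_mem _
  obtain ⟨p, hp, hpd, hpI⟩ := exists_monic_eval₂_mem (aeval (R := K) z).toRingHom I G
    (fun f => by
      obtain ⟨P, hP⟩ := hw.exists_eq_sum f
      refine ⟨fun a => kill (P a), ?_⟩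
      rw [hP, ← Finset.sum_sub_distrib]
      refine Ideal.sum_mem _ fun a _ => ?_
      rw [← sub_mul]
      exact Ideal.mul_mem_right _ _ (hkill _)) y
  let _ := MvPolynomial.gradedAlgebra (σ := σ) (R := K)
  have hIhom : I.IsHomogeneous (homogeneousSubmodule σ K) := by
    rw [← hw.span_eq]
    refine Ideal.homogeneous_span _ _ ?_
    rintro _ ⟨l, _, rfl⟩
    obtain ⟨d, _, hd⟩ := hw.homogeneous l
    exact ⟨d, hd⟩
  set R := p.natDegree with hR
  have h1 := homogeneousComponent_mem_of_mem hIhom hpI (R * e)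
  rw [Polynomial.eval₂_eq_sum_range, map_sum] at h1
  have h2 : ∑ t ∈ Finset.range (R + 1),
      aeval z (homogeneousComponent (R * e - e * t) (p.coeff t)) * y ^ t ∈ I := by
    convert! h1 using 2 with t ht
    refine (homogeneousComponent_aeval_mul hz (hy.pow t) ?_ _).symm
    rw [mul_comm]
    exact Nat.mul_le_mul_right _ (by have := Finset.mem_range.mp ht; omega)
  have hRE : R * e ≤ Fintype.card ι * e := Nat.mul_le_mul_right _ hpd
  obtain ⟨t, htR, ht0, htI⟩ := exists_aeval_mem_of_sum_mem hz hy hreg R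
    (fun t => homogeneousComponent (R * e - e * t) (p.coeff t))
    (fun t _ => by
      rw [mul_comm e t, ← Nat.sub_mul]
      exact homogeneousComponent_isHomogeneous _ _)
    (by
      rw [mul_comm e R, Nat.sub_self, hp.coeff_natDegree, homogeneousComponent_zero]
      simp) (hRE.trans hE) h2
  exact ⟨_, _, (Nat.sub_le _ _).trans hRE, ht0, homogeneousComponent_isHomogeneous _ _, htI⟩

end IsParam

end MvPolynomial

end

section

open MvPolynomial

namespace MvPolynomial.IsParam

variable {K σ : Type*} [Field K] {ι : Type} [Fintype ι] {D : Set σ} {w : σ → MvPolynomial σ K}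
  {I : Ideal (MvPolynomial σ K)} {G : ι → MvPolynomial σ K}

theorem constantCoeff_eq_zero (hw : IsParam D w I G) {y : MvPolynomial σ K} {e : ℕ}
    (hy : y.IsHomogeneous e) (he : 0 < e) {f : MvPolynomial σ K} (hf : f ∈ I ⊔ Ideal.span {y}) :
    constantCoeff f = 0 := by
  have key : ∀ (g : MvPolynomial σ K) d, 0 < d → g.IsHomogeneous d → constantCoeff g = 0 :=
    fun g d hd hg => hg.coeff_eq_zero (by simpa using hd.ne)
  have : I ⊔ Ideal.span {y} ≤ RingHom.ker (constantCoeff (R := K) (σ := σ)) := by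
    rw [← hw.span_eq, sup_le_iff, Ideal.span_le, Ideal.span_le]
    refine ⟨?_, by rintro _ rfl; exact key _ _ he hy⟩
    rintro _ ⟨l, _, rfl⟩
    obtain ⟨d, hd, hl⟩ := hw.homogeneous l
    exact key _ _ hd hl
  exact this hf

/-- Adjoining an element regular up to a large degree to the ideal of a system of parameters. -/
theorem exists_sup_span [Finite σ] [Infinite K] (hw : IsParam D w I G) {y : MvPolynomial σ K}
    {e E : ℕ} (hy : y.IsHomogeneous e) (he : 0 < e)
    (hreg : ∀ n ≤ E, ∀ f : MvPolynomial σ K, f.IsHomogeneous n → y * f ∈ I → f ∈ I)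
    (hE : Fintype.card ι * e ≤ E) :
    (∀ f, y * f ∈ I → f ∈ I) ∧
      ∃ (D' : Set σ) (wz : σ → MvPolynomial σ K) (ι' : Type) (_ : Fintype ι')
        (G' : ι' → MvPolynomial σ K), Fintype.card ι' ≤ Fintype.card ι * (Fintype.card ι * e) ∧
          IsParam D' wz (I ⊔ Ideal.span {y}) G' := by
  classical
  obtain ⟨h, s, hs, h0, hh, hI⟩ := hw.exists_form hy hreg hE
  have hs0 : s ≠ 0 := by
    rintro rfl
    have h1 := totalDegree_eq_zero_iff_eq_C.mp (hh.totalDegree h0)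
    rw [h1] at hI
    have h2 := hw.constantCoeff_eq_zero hy he hI
    rw [algHom_C, algebraMap_eq, constantCoeff_C] at h2
    exact h0 (by rw [h1, h2, C_0])
  obtain ⟨l₀⟩ : Nonempty {l // l ∉ D} := by
    by_contra hne
    rw [not_nonempty_iff] at hne
    obtain ⟨m, hm⟩ := exists_coeff_ne_zero h0
    have := hh hm
    rw [Subsingleton.elim m 0, map_zero] at this
    exact hs0 this.symm
  obtain ⟨p, hp, hph⟩ := exists_eval_ne_zero_of_isHomogeneous hh h0 l₀
  obtain ⟨l₀, hl₀⟩ := l₀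
  let p' : σ → K := fun l => if hl : l ∉ D then p ⟨l, hl⟩ else 0
  let wz : σ → MvPolynomial σ K := fun l => if l = l₀ then w l₀ else w l - C (p' l) * w l₀
  have hwzl₀ : wz l₀ = w l₀ := if_pos rfl
  have hwzD : ∀ l ∈ D, wz l = w l := fun l hl => by
    have : l ≠ l₀ := fun h => hl₀ (h ▸ hl)
    simp [wz, this, p', hl]
  have hcomp : aeval (R := K) wz = (aeval w).comp (shearHom l₀ (-p')) := by
    refine algHom_ext fun l => ?_
    by_cases hl : l = l₀
    · simp [shearHom, hl, wz]
    · simp [shearHom, hl, wz, algHom_C, algebraMap_eq]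
      ring
  have hcomp' : ∀ P, aeval w P = aeval wz (shearHom l₀ p' P) := fun P => by
    rw [hcomp, AlgHom.comp_apply, ← AlgHom.comp_apply (shearHom l₀ (-p')),
      shearHom_comp _ _ _ fun l => by simp, AlgHom.id_apply]
  have hflat' : (aeval (R := K) wz).toRingHom.Flat := by
    rw [hcomp]
    exact RingHom.Flat.comp (RingHom.Flat.of_bijective (shear l₀ (-p')).bijective) hw.flat
  have hwz1 : ∀ l, l ∉ D → (wz l).IsHomogeneous 1 := fun l hl => by
    by_cases hll : l = l₀
    · rw [hll, hwzl₀]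
      exact hw.linear _ hl₀
    · simp only [wz, if_neg hll]
      exact (hw.linear l hl).sub ((hw.linear l₀ hl₀).C_mul _)
  have hwzh : ∀ l, ∃ d, 0 < d ∧ (wz l).IsHomogeneous d := fun l => by
    by_cases hl : l ∈ D
    · rw [hwzD l hl]
      exact hw.homogeneous l
    · exact ⟨1, one_pos, hwz1 l hl⟩
  set Q := Ideal.span (wz '' {l₀}ᶜ) with hQ
  have hID : Ideal.span (wz '' D) = I := by
    rw [← hw.span_eq, Set.image_congr hwzD]
  have hIQ : I ≤ Q := by
    rw [← hID]
    exact Ideal.span_mono (Set.image_mono fun l hl h => hl₀ (h ▸ hl))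
  have hpow : w l₀ ^ s ∈ Q ⊔ Ideal.span {y} := by
    have h1 : aeval (fun l : {l // l ∉ D} => w l) h ∈ Q ⊔ Ideal.span {y} :=
      sup_le_sup_right hIQ _ hI
    have h2 := aeval_sub_aeval_mem (I := Q) (v := fun l : {l // l ∉ D} => w l)
      (w := fun l => algebraMap K _ (p l) * w l₀) (fun l => by
        by_cases hll : (l : σ) = l₀
        · have : l = ⟨l₀, hl₀⟩ := Subtype.ext hll
          simp [this, hp]
        · refine Ideal.subset_span ⟨l, hll, ?_⟩
          simp only [wz, if_neg hll, p', dif_pos l.2, algebraMap_eq]) h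
    rw [aeval_algebraMap_mul_of_isHomogeneous hh] at h2
    have h3 := Submodule.sub_mem _ h1 (Submodule.mem_sup_left h2)
    rw [sub_sub_cancel] at h3
    have h4 := Ideal.mul_mem_left _ (algebraMap K _ (eval p h)⁻¹) h3
    rwa [← mul_assoc, ← map_mul, inv_mul_cancel₀ hph, map_one, one_mul] at h4
  have hcancel : ∀ n f, w l₀ ^ n * f ∈ Q → f ∈ Q := fun n => by
    induction n with
    | zero => intro f hf; simpa using hf
    | succ n ih =>
      intro f hf
      rw [pow_succ', mul_assoc, ← hwzl₀] at hf
      exact ih _ (by rw [← hwzl₀]; exact mem_span_image_of_flat hflat' (by simp) hf)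
  have hyQ : ∀ f, y * f ∈ Q → f ∈ Q := fun f hf => by
    obtain ⟨q, hq, u, hu, hqu⟩ := Submodule.mem_sup.mp hpow
    obtain ⟨v, rfl⟩ := Ideal.mem_span_singleton'.mp hu
    refine hcancel s f ?_
    rw [← hqu, show (q + v * y) * f = f * q + v * (y * f) by ring]
    exact Ideal.add_mem _ (Ideal.mul_mem_left _ _ hq) (Ideal.mul_mem_left _ _ hf)
  let wy : σ → MvPolynomial σ K := Function.update wz l₀ y
  have hwyl₀ : wy l₀ = y := Function.update_self ..
  have hwyne : ∀ l, l ≠ l₀ → wy l = wz l := fun l hl => Function.update_of_ne hl ..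
  have himage : ∀ J : Set σ, l₀ ∉ J → wy '' J = wz '' J := fun J hJ =>
    Set.image_congr fun l hl => hwyne l fun h => hJ (h ▸ hl)
  have hwyh : ∀ l, ∃ d, 0 < d ∧ (wy l).IsHomogeneous d := fun l => by
    by_cases hl : l = l₀
    · exact ⟨e, he, by rwa [hl, hwyl₀]⟩
    · rw [hwyne l hl]
      exact hwzh l
  choose d hd hdw using hwyh
  have hflat'' : (aeval (R := K) wy).toRingHom.Flat := by
    refine flat_aeval_of_regular_last hdw hd l₀ (fun J j hj hJ hjl f hf => ?_) fun f hf => ?_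
    · rw [himage J hJ, hwyne j hjl] at hf
      rw [himage J hJ]
      exact mem_span_image_of_flat hflat' hj hf
    · rw [himage _ (by simp), hwyl₀] at hf
      rw [himage _ (by simp)]
      exact hyQ f hf
  refine ⟨fun f hf => ?_, insert l₀ D, wy, ι × Fin s, inferInstance,
    fun b => G b.1 * w l₀ ^ (b.2 : ℕ), ?_, fun l => ⟨d l, hd l, hdw l⟩, fun l hl => ?_, hflat'',
    ?_, fun b => ?_, ?_⟩
  · rw [← hID, ← himage D hl₀] at hf ⊢
    rw [← hwyl₀] at hf
    exact mem_span_image_of_flat hflat'' hl₀ hf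
  · rw [Fintype.card_prod, Fintype.card_fin]
    exact Nat.mul_le_mul_left _ hs
  · rw [Set.mem_insert_iff, not_or] at hl
    rw [hwyne l hl.1]
    exact hwz1 l hl.2
  · rw [Set.image_insert_eq, Ideal.span_insert, himage D hl₀, hID, hwyl₀, sup_comm]
  · obtain ⟨n, hn⟩ := hw.homogeneous_gen b.1
    exact ⟨_, hn.mul ((hw.linear l₀ hl₀).pow _)⟩
  let T : Set (MvPolynomial σ K) := {t | ∃ (m : σ →₀ ℕ) (b : ι × Fin s),
    t = aeval wy (monomial m (1 : K)) * (G b.1 * w l₀ ^ (b.2 : ℕ))}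
  have hT : Submodule.span K T = ⊤ := by
    refine span_eq_top_of_sup_span_eq_top hdw hd ?_ ?_ ?_
    · rintro _ ⟨m, b, rfl⟩
      obtain ⟨n, hn⟩ := hw.homogeneous_gen b.1
      refine ⟨_, IsHomogeneous.mul (m := ∑ l ∈ m.support, d l * m l) ?_
        (hn.mul ((hw.linear l₀ hl₀).pow _))⟩
      rw [aeval_monomial, map_one, one_mul]
      exact IsHomogeneous.prod _ _ _ fun l _ => (hdw l).pow _
    · rintro l _ ⟨m, b, rfl⟩
      refine Submodule.subset_span ⟨m + Finsupp.single l 1, b, ?_⟩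
      rw [monomial_add_single, pow_one, map_mul, aeval_X]
      ring
    · have hQle : Q ⊔ Ideal.span {y} ≤ Ideal.span (Set.range wy) := by
        rw [hQ, ← himage _ (by simp), ← hwyl₀]
        exact sup_le (Ideal.span_mono (Set.image_subset_range _ _))
          (Ideal.span_mono (by rintro _ rfl; exact ⟨_, rfl⟩))
      let V := Submodule.span K T ⊔ (Ideal.span (Set.range wy)).restrictScalars K
      have hV : ∀ f, f ∈ V := by
        intro f
        obtain ⟨P, rfl⟩ := hw.exists_eq_sum f
        refine Submodule.sum_mem _ fun a _ => ?_
        rw [hcomp']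
        generalize shearHom l₀ p' (P a) = F
        rw [F.as_sum, map_sum, Finset.sum_mul]
        refine Submodule.sum_mem _ fun m _ => ?_
        rw [aeval_monomial]
        by_cases hm : ∃ l, l ≠ l₀ ∧ m l ≠ 0
        · obtain ⟨l, hl, hml⟩ := hm
          have hlQ : wz l ∈ Q := Ideal.subset_span ⟨l, hl, rfl⟩
          refine Submodule.mem_sup_right (hQle (Submodule.mem_sup_left ?_))
          refine Ideal.mul_mem_right _ _ (Ideal.mul_mem_left _ _ (Ideal.mem_of_dvd _
            (Finset.dvd_prod_of_mem _ (Finsupp.mem_support_iff.mpr hml))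
            (Ideal.pow_mem_of_mem _ hlQ _ (Nat.pos_of_ne_zero hml))))
        · push Not at hm
          obtain ⟨t, rfl⟩ : ∃ t, m = Finsupp.single l₀ t := ⟨m l₀, Finsupp.ext fun l => by
            by_cases hl : l = l₀
            · simp [hl]
            · simp [hm l hl, Ne.symm hl]⟩
          have hprod : ((Finsupp.single l₀ t).prod fun i k => wz i ^ k) = w l₀ ^ t := by
            rw [Finsupp.prod_single_index (h := fun i k => wz i ^ k) (pow_zero _), hwzl₀]
          rw [hprod]
          by_cases ht : t < s
          · refine Submodule.mem_sup_left ?_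
            rw [mul_assoc, ← Algebra.smul_def]
            refine Submodule.smul_mem _ _ (Submodule.subset_span ⟨0, (a, ⟨t, ht⟩), ?_⟩)
            rw [monomial_zero', C_1, map_one, one_mul, mul_comm]
          · refine Submodule.mem_sup_right (hQle ?_)
            refine Ideal.mul_mem_right _ _ (Ideal.mul_mem_left _ _ ?_)
            rw [← Nat.sub_add_cancel (not_lt.mp ht), pow_add]
            exact Ideal.mul_mem_left _ _ hpow
      intro f
      obtain ⟨v, hv, q, hq, hvq⟩ := Submodule.mem_sup.mp (hV f)
      refine ⟨v, hv, ?_⟩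
      rw [← hvq, add_sub_cancel_left]
      exact hq
  intro f
  have hf : f ∈ Submodule.span K T := hT ▸ Submodule.mem_top
  induction hf using Submodule.span_induction with
  | mem x hx =>
    obtain ⟨m, b, rfl⟩ := hx
    refine ⟨Pi.single b (monomial m 1), ?_⟩
    rw [Finset.sum_eq_single b, Pi.single_eq_same]
    · intro c _ hc
      rw [Pi.single_eq_of_ne hc, map_zero, zero_mul]
    · simp
  | zero => exact ⟨0, by simp⟩
  | add x z _ _ hx hz =>
    obtain ⟨P, hP⟩ := hx
    obtain ⟨P', hP'⟩ := hz
    refine ⟨P + P', ?_⟩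
    rw [hP, hP', ← Finset.sum_add_distrib]
    simp [add_mul]
  | smul c x _ hx =>
    obtain ⟨P, hP⟩ := hx
    refine ⟨c • P, ?_⟩
    rw [hP, Finset.smul_sum]
    simp

end MvPolynomial.IsParam

namespace MvPolynomial

theorem isParam_X {K σ : Type*} [Field K] :
    IsParam (K := K) (σ := σ) (ι := Unit) ∅ X ⊥ 1 where
  homogeneous l := ⟨1, one_pos, isHomogeneous_X _ _⟩
  linear l _ := isHomogeneous_X _ _
  flat := RingHom.Flat.of_bijective (by
    rw [aeval_X_left]
    exact Function.bijective_id)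
  span_eq := by simp
  homogeneous_gen _ := ⟨0, isHomogeneous_one _ _⟩
  exists_eq_sum f := ⟨fun _ => f, by simp⟩

/-- Homogeneous elements that form a regular sequence up to a degree depending only on their number
and degrees generate a polynomial ring over which the ambient polynomial ring is flat. -/
theorem exists_flat_aeval_of_regular_le {k : ℕ} (e : Fin k → ℕ) (he : ∀ j, 0 < e j) :
    ∃ E : ℕ, ∀ (K : Type u) [Field K] [Infinite K] (σ : Type v) [Finite σ]
      (y : Fin k → MvPolynomial σ K), (∀ j, (y j).IsHomogeneous (e j)) →
      (∀ j, ∀ n ≤ E, ∀ f : MvPolynomial σ K, f.IsHomogeneous n →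
        y j * f ∈ Ideal.span (y '' {l | l < j}) → f ∈ Ideal.span (y '' {l | l < j})) →
      (aeval (R := K) y).toRingHom.Flat := by
  suffices key : ∀ r ≤ k, ∃ E R : ℕ, ∀ (K : Type u) [Field K] [Infinite K] (σ : Type v) [Finite σ]
      (y : Fin k → MvPolynomial σ K), (∀ j, (y j).IsHomogeneous (e j)) →
      (∀ j, ∀ n ≤ E, ∀ f : MvPolynomial σ K, f.IsHomogeneous n →
        y j * f ∈ Ideal.span (y '' {l | l < j}) → f ∈ Ideal.span (y '' {l | l < j})) →
      (∀ j : Fin k, (j : ℕ) < r → ∀ f : MvPolynomial σ K,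
        y j * f ∈ Ideal.span (y '' {l | l < j}) → f ∈ Ideal.span (y '' {l | l < j})) ∧
      ∃ (D : Set σ) (w : σ → MvPolynomial σ K) (ι : Type) (_ : Fintype ι)
        (G : ι → MvPolynomial σ K), Fintype.card ι ≤ R ∧
          IsParam D w (Ideal.span (y '' {l | (l : ℕ) < r})) G by
    obtain ⟨E, R, h⟩ := key k le_rfl
    refine ⟨E, fun K _ _ σ _ y hy hreg => ?_⟩
    exact flat_aeval_of_regular hy he fun j => (h K σ y hy hreg).1 j j.2
  intro r
  induction r with
  | zero =>
    intro _
    refine ⟨0, 1, fun K _ _ σ _ y hy hreg => ⟨fun j hj => by omega, ∅, X, Unit, inferInstance, 1,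
      by simp, ?_⟩⟩
    convert! isParam_X
    simp
  | succ r ih =>
    intro hr
    obtain ⟨E, R, h⟩ := ih (by omega)
    let i : Fin k := ⟨r, hr⟩
    refine ⟨max E (R * e i), R * (R * e i), fun K _ _ σ _ y hy hreg => ?_⟩
    obtain ⟨hr1, D, w, ι, _, G, hcard, hw⟩ := h K σ y hy fun j n hn =>
      hreg j n (hn.trans (le_max_left _ _))
    have hcard' := Nat.mul_le_mul_right (e i) hcard
    obtain ⟨hyi, D', w', ι', _, G', hcard2, hw'⟩ := hw.exists_sup_span (hy i) (he i)
      (hreg i) (hcard'.trans (le_max_right _ _))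
    refine ⟨fun j hj => ?_, D', w', ι', inferInstance, G', hcard2.trans ?_, ?_⟩
    · rcases Nat.lt_succ_iff_lt_or_eq.mp hj with hj | hj
      · exact hr1 j hj
      · obtain rfl : j = i := Fin.ext hj
        exact hyi
    · exact Nat.mul_le_mul hcard hcard'
    · convert! hw' using 1
      have : {l : Fin k | (l : ℕ) < r + 1} = insert i {l : Fin k | (l : ℕ) < r} := by
        ext l
        simp only [Set.mem_ofPred_eq, Set.mem_insert_iff, Fin.ext_iff, i]
        omega
      rw [this, Set.image_insert_eq, Ideal.span_insert, sup_comm]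

end MvPolynomial

end

section

open MvPolynomial

/-- Bounds on solutions of linear systems are transported along flat substitutions. -/
theorem KerBound.aeval_of_flat {K σ τ ι κ : Type*} [CommRing K] [Fintype ι] [Finite κ]
    {C : κ → ι → MvPolynomial τ K} {B e : ℕ} (hC : KerBound C B) {w : τ → MvPolynomial σ K}
    (hw : (aeval (R := K) w).toRingHom.Flat) (he : ∀ l, (w l).totalDegree ≤ e) :
    KerBound (fun k j => aeval w (C k j)) (B * (e + 1)) := by
  classical
  obtain ⟨g, h1, h2, h3⟩ := hC
  refine KerBound.of_family (α := Fin B)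
    (by rw [Fintype.card_fin]; exact Nat.le_mul_of_pos_right _ e.succ_pos)
    (fun a j => aeval w (g a j)) (fun a j => ?_) (fun a k => ?_) fun s hs => ?_
  · exact (totalDegree_aeval_le _ _ he).trans (Nat.mul_le_mul (h1 a j) e.le_succ)
  · simp_rw [← map_mul]
    rw [← map_sum, h2, map_zero]
  obtain ⟨f, hf, hflat⟩ : ∃ f : MvPolynomial τ K →+* MvPolynomial σ K,
      (∀ x, f x = aeval w x) ∧ f.Flat := ⟨_, fun x => rfl, hw⟩
  simp_rw [← hf] at hs ⊢
  let _ : Algebra (MvPolynomial τ K) (MvPolynomial σ K) := f.toAlgebra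
  have : Module.Flat (MvPolynomial τ K) (MvPolynomial σ K) := hflat
  have hsmul : ∀ (a : MvPolynomial τ K) (b : MvPolynomial σ K), a • b = f a * b :=
    fun a b => rfl
  let x := Fintype.linearCombination (MvPolynomial τ K) s
  have := Fintype.ofFinite κ
  let F := Fintype.linearCombination (MvPolynomial τ K) C
  have hxF : x ∘ₗ F = 0 := by
    refine LinearMap.pi_ext' fun k => LinearMap.ext_ring ?_
    simp only [x, F, LinearMap.comp_apply, LinearMap.single_apply,
      Fintype.linearCombination_apply_single, one_smul, LinearMap.zero_apply]
    rw [Fintype.linearCombination_apply]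
    simp_rw [hsmul]
    exact hs k
  obtain ⟨n, a, y, hya, haf⟩ := Module.Flat.exists_factorization_of_comp_eq_zero_of_free hxF
  have hker : ∀ t : Fin n, ∀ k, ∑ j, C k j * a (Pi.single j 1) t = 0 := fun t k => by
    have h4 := DFunLike.congr_fun (LinearMap.congr_fun haf (Pi.single k 1)) t
    simp only [F, LinearMap.comp_apply, Fintype.linearCombination_apply_single, one_smul,
      LinearMap.zero_apply, Finsupp.coe_zero, Pi.zero_apply] at h4
    rw [← Finset.univ_sum_single (C k), map_sum, Finsupp.finsetSum_apply] at h4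
    rw [← h4]
    refine Finset.sum_congr rfl fun j _ => ?_
    have : (Pi.single j (C k j) : ι → MvPolynomial τ K) = C k j • Pi.single j 1 := by
      rw [← Pi.single_smul, smul_eq_mul, mul_one]
    rw [this, map_smul, Finsupp.smul_apply, smul_eq_mul]
  choose c hc using fun t => h3 (fun j => a (Pi.single j 1) t) (hker t)
  refine ⟨fun b => ∑ t, f (c t b) * y (Finsupp.single t 1), fun j => ?_⟩
  have h5 := LinearMap.congr_fun hya (Pi.single j 1)
  simp only [x, Fintype.linearCombination_apply_single, one_smul, LinearMap.comp_apply] at h5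
  rw [h5, ← Finsupp.univ_sum_single (a (Pi.single j 1)), map_sum]
  simp_rw [Finset.sum_mul]
  rw [Finset.sum_comm]
  refine Finset.sum_congr rfl fun t _ => ?_
  have : Finsupp.single t (a (Pi.single j 1) t) =
      a (Pi.single j 1) t • Finsupp.single t (1 : MvPolynomial τ K) := by
    rw [Finsupp.smul_single, smul_eq_mul, mul_one]
  rw [this, map_smul, hsmul, hc, map_sum, Finset.sum_mul]
  refine Finset.sum_congr rfl fun b _ => ?_
  rw [map_mul]
  ring

namespace MvPolynomial

variable {K σ : Type*} [Field K]

theorem sum_range_homogeneousComponent {Q : MvPolynomial σ K} {n : ℕ}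
    (hQ : ∀ m, coeff m Q ≠ 0 → m.degree < n) :
    ∑ l ∈ Finset.range n, homogeneousComponent l Q = Q := by
  classical
  ext m
  simp_rw [coeff_sum, coeff_homogeneousComponent]
  rw [Finset.sum_ite_eq]
  by_cases hm : coeff m Q = 0
  · rw [hm, ite_self]
  · rw [if_pos (Finset.mem_range.mpr (hQ m hm))]

theorem homogeneousComponent_mul_of_isHomogeneous {y : MvPolynomial σ K} {e : ℕ}
    (hy : y.IsHomogeneous e) (n : ℕ) (a : MvPolynomial σ K) :
    homogeneousComponent n (a * y) =
      if e ≤ n then homogeneousComponent (n - e) a * y else 0 := by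
  have hc : ∀ i, (homogeneousComponent i a * y).IsHomogeneous (i + e) := fun i =>
    (homogeneousComponent_isHomogeneous i a).mul hy
  conv_lhs => rw [← sum_homogeneousComponent a, Finset.sum_mul, map_sum]
  split_ifs with h
  · rw [Finset.sum_eq_single (n - e)]
    · rw [homogeneousComponent_of_mem (hc _), if_pos (by omega)]
    · intro i _ hi
      rw [homogeneousComponent_of_mem (hc _), if_neg (by omega)]
    · intro hi
      have h0 : homogeneousComponent (n - e) a = 0 :=
        homogeneousComponent_eq_zero _ _ (by have := Finset.mem_range.not.mp hi; omega)
      rw [h0, zero_mul, map_zero]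
  · refine Finset.sum_eq_zero fun i _ => ?_
    rw [homogeneousComponent_of_mem (hc _), if_neg (by omega)]

/-- A homogeneous combination of homogeneous polynomials has coefficients of bounded degree. -/
theorem IsHomogeneous.exists_eq_sum_of_mem_span {ι : Type*} {f : MvPolynomial σ K} {n : ℕ}
    (hf : f.IsHomogeneous n) {y : ι → MvPolynomial σ K} {e : ι → ℕ}
    (hy : ∀ l, (y l).IsHomogeneous (e l)) {J : Finset ι} (h : f ∈ Ideal.span (y '' J)) :
    ∃ a : ι → MvPolynomial σ K, (∀ l, (a l).totalDegree ≤ n) ∧ f = ∑ l ∈ J, a l * y l := by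
  obtain ⟨a, ha⟩ := (Submodule.mem_span_image_finset_iff_exists_fun' _).mp h
  refine ⟨fun l => if e l ≤ n then homogeneousComponent (n - e l) (a l) else 0, fun l => ?_, ?_⟩
  · dsimp only
    split_ifs
    · exact (homogeneousComponent_isHomogeneous _ _).totalDegree_le.trans (Nat.sub_le _ _)
    · simp
  · have h1 : homogeneousComponent n f = f := by
      rw [homogeneousComponent_of_mem hf, if_pos rfl]
    rw [← h1, ← ha, map_sum]
    refine Finset.sum_congr rfl fun l _ => ?_
    rw [smul_eq_mul, homogeneousComponent_mul_of_isHomogeneous (hy l), ite_mul, zero_mul]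

/-- The translation by a vector. -/
noncomputable def translation (u : σ → K) : MvPolynomial σ K →ₐ[K] MvPolynomial σ K :=
  aeval fun j => X j + C (u j)

theorem totalDegree_translation_le (u : σ → K) (f : MvPolynomial σ K) :
    (translation u f).totalDegree ≤ f.totalDegree := by
  refine (totalDegree_aeval_le f _ (e := 1) fun j => ?_).trans (mul_one _).le
  exact (totalDegree_add _ _).trans (by simp [totalDegree_X])

theorem translation_eq_add_sum {u : σ → K} {f : MvPolynomial σ K} {n : ℕ} (hf : f.IsHomogeneous n) :
    translation u f =
      f + ∑ l ∈ Finset.range n, homogeneousComponent l (translation u f) := by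
  have h : ∀ m, coeff m (translation u f - f) ≠ 0 → m.degree < n := by
    have := WeightLT.aeval_sub (e := (1 : σ → ℕ)) (q := fun j => C (u j)) (fun j m hm => by
      classical
      rw [coeff_C] at hm
      have : 0 = m := by by_contra h; exact hm (if_neg h)
      simp [← this]) hf
    intro m hm
    rw [Finsupp.degree_eq_weight_one]
    exact this m hm
  have h2 := sum_range_homogeneousComponent h
  have h3 : ∀ l ∈ Finset.range n, homogeneousComponent l (translation u f - f) =
      homogeneousComponent l (translation u f) := fun l hl => by
    rw [map_sub, homogeneousComponent_of_mem hf, if_neg (Finset.mem_range.mp hl).ne, sub_zero]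
  rw [Finset.sum_congr rfl h3] at h2
  rw [h2, add_sub_cancel]

theorem eq_C_of_translation_eq [Infinite K] {f : MvPolynomial σ K}
    (h : ∀ u, translation u f = f) : f = C (eval 0 f) := by
  refine funext fun u => ?_
  have h1 : ∀ g, eval 0 (translation u g) = eval u g := fun g => by
    have : (aeval 0).comp (translation u) = aeval (R := K) u := algHom_ext fun j => by
      simp [translation]
    exact DFunLike.congr_fun this g
  rw [eval_C, ← h1, h]

end MvPolynomial

end

section

open MvPolynomial Filter

/-- Families of polynomials of bounded total degree. -/
def boundedPoly (K : ℕ → Type u) [∀ i, Field (K i)] (N : ℕ → ℕ) :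
    Subring (∀ i, MvPolynomial (Fin (N i)) (K i)) where
  carrier := {f | ∃ d, ∀ i, (f i).totalDegree ≤ d}
  mul_mem' := by
    rintro f g ⟨d, hd⟩ ⟨e, he⟩
    exact ⟨d + e, fun i => (totalDegree_mul _ _).trans (add_le_add (hd i) (he i))⟩
  one_mem' := ⟨0, fun i => by simp⟩
  add_mem' := by
    rintro f g ⟨d, hd⟩ ⟨e, he⟩
    exact ⟨max d e, fun i => (totalDegree_add _ _).trans (max_le_max (hd i) (he i))⟩
  zero_mem' := ⟨0, fun i => by simp⟩
  neg_mem' := by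
    rintro f ⟨d, hd⟩
    exact ⟨d, fun i => by simpa using hd i⟩

/-- The family of constant polynomials attached to a family of scalars. -/
noncomputable def boundedPoly.const (K : ℕ → Type u) [∀ i, Field (K i)] (N : ℕ → ℕ) :
    (∀ i, K i) →+* boundedPoly K N :=
  (RingHom.pi fun i => (C : K i →+* MvPolynomial (Fin (N i)) (K i)).comp
    (Pi.evalRingHom K i)).codRestrict _ fun c => ⟨0, fun i => by simp⟩

/-- `κ` and `π` exhibit `F` as an ultraproduct of the fields `K i` and `S` as the ring of elements
of bounded degree of the ultraproduct of the polynomial rings over `K i`. -/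
structure IsBoundedUltraproduct (U : Ultrafilter ℕ) {K : ℕ → Type u} [∀ i, Field (K i)]
    {N : ℕ → ℕ} {F S : Type u} [Field F] [CommRing S] [Algebra F S] (κ : (∀ i, K i) →+* F)
    (π : boundedPoly K N →+* S) : Prop where
  surjective_scalar : Function.Surjective κ
  surjective : Function.Surjective π
  eq_zero_iff : ∀ f, π f = 0 ↔ ∀ᶠ i in U, f.1 i = 0
  algebraMap_eq : ∀ c, algebraMap F S (κ c) = π (boundedPoly.const K N c)

namespace IsBoundedUltraproduct

variable {U : Ultrafilter ℕ} {K : ℕ → Type u} [∀ i, Field (K i)]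
  {N : ℕ → ℕ} {F S : Type u} [Field F] [CommRing S] [Algebra F S] {κ : (∀ i, K i) →+* F}
  {π : boundedPoly K N →+* S}

theorem eq_iff (h : IsBoundedUltraproduct U κ π) (f g : boundedPoly K N) :
    π f = π g ↔ ∀ᶠ i in U, f.1 i = g.1 i := by
  rw [← sub_eq_zero, ← map_sub, h.eq_zero_iff]
  simp [sub_eq_zero]

theorem nontrivial (h : IsBoundedUltraproduct U κ π) : Nontrivial S := by
  refine ⟨π 1, 0, fun h1 => ?_⟩
  obtain ⟨i, hi⟩ := ((h.eq_zero_iff 1).mp h1).exists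
  exact one_ne_zero hi

theorem isReduced (h : IsBoundedUltraproduct U κ π) : IsReduced S := by
  refine ⟨fun x ⟨n, hn⟩ => ?_⟩
  obtain ⟨f, rfl⟩ := h.surjective x
  rw [← map_pow, h.eq_zero_iff] at hn
  rw [h.eq_zero_iff]
  filter_upwards [hn] with i hi
  exact eq_zero_of_pow_eq_zero (R := MvPolynomial (Fin (N i)) (K i)) hi

/-- The classes of families of homogeneous polynomials of degree `e`. -/
def grading (h : IsBoundedUltraproduct U κ π) (e : ℕ) : Submodule F S where
  carrier := {s | ∃ f : boundedPoly K N, (∀ i, (f.1 i).IsHomogeneous e) ∧ π f = s}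
  add_mem' := by
    rintro _ _ ⟨f, hf, rfl⟩ ⟨g, hg, rfl⟩
    exact ⟨f + g, fun i => (hf i).add (hg i), map_add _ _ _⟩
  zero_mem' := ⟨0, fun _ => isHomogeneous_zero _ _ _, map_zero _⟩
  smul_mem' := by
    rintro a _ ⟨f, hf, rfl⟩
    obtain ⟨c, rfl⟩ := h.surjective_scalar a
    refine ⟨boundedPoly.const K N c * f, fun i => (hf i).C_mul _, ?_⟩
    rw [map_mul, ← h.algebraMap_eq, Algebra.smul_def]

/-- Componentwise homogeneous component. -/
noncomputable def component (f : boundedPoly K N) (l : ℕ) : boundedPoly K N :=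
  ⟨fun i => homogeneousComponent l (f.1 i), l, fun _ =>
    (homogeneousComponent_isHomogeneous _ _).totalDegree_le⟩

theorem component_mem (h : IsBoundedUltraproduct U κ π) (f : boundedPoly K N) (l : ℕ) :
    π (component f l) ∈ h.grading l :=
  ⟨_, fun _ => homogeneousComponent_isHomogeneous _ _, rfl⟩

theorem isConnectedGrading (h : IsBoundedUltraproduct U κ π) :
    IsConnectedGrading h.grading where
  zero f hf := by
    obtain ⟨f, hf, rfl⟩ := hf
    refine ⟨κ fun i => coeff 0 (f.1 i), ?_⟩
    rw [h.algebraMap_eq, h.eq_iff]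
    refine Eventually.of_forall fun i => ?_
    have h0 : (f.1 i).totalDegree = 0 := Nat.le_zero.mp (hf i).totalDegree_le
    exact (totalDegree_eq_zero_iff_eq_C.mp h0).symm
  one := ⟨1, fun i => isHomogeneous_one _ _, map_one _⟩
  mul i j f g hf hg := by
    obtain ⟨f, hf, rfl⟩ := hf
    obtain ⟨g, hg, rfl⟩ := hg
    exact ⟨f * g, fun i => (hf i).mul (hg i), map_mul _ _ _⟩
  exists_sum s := by
    obtain ⟨f, rfl⟩ := h.surjective s
    obtain ⟨d, hd⟩ := f.2
    refine ⟨d + 1, fun l => π (component f l), h.component_mem f, ?_⟩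
    rw [← map_sum]
    congr 1
    refine Subtype.ext (funext fun i => ?_)
    rw [AddSubmonoidClass.coe_finsetSum, Finset.sum_apply]
    refine (sum_range_homogeneousComponent fun m hm => ?_).symm
    exact Nat.lt_succ_of_le ((le_totalDegree (mem_support_iff.mpr hm)).trans (hd i))
  eq_zero n a ha h0 l hl := by
    choose f hf hfa using ha
    simp_rw [← hfa] at h0 ⊢
    rw [← map_sum, h.eq_zero_iff] at h0
    rw [h.eq_zero_iff]
    filter_upwards [h0] with i hi
    rw [AddSubmonoidClass.coe_finsetSum, Finset.sum_apply] at hi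
    have h1 := congrArg (homogeneousComponent l) hi
    rw [map_sum, map_zero, Finset.sum_eq_single l] at h1
    · rwa [homogeneousComponent_of_mem (hf l i), if_pos rfl] at h1
    · intro j _ hj
      rw [homogeneousComponent_of_mem (hf j i), if_neg hj.symm]
    · intro hl'
      exact absurd (Finset.mem_range.mpr hl) hl'

/-- Componentwise translation. -/
noncomputable def translationFamily (u : ∀ i, Fin (N i) → K i) :
    boundedPoly K N →+* boundedPoly K N :=
  ((RingHom.pi fun i => ((translation (u i)).toRingHom.comp
    (Pi.evalRingHom (fun i => MvPolynomial (Fin (N i)) (K i)) i))).comp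
      (boundedPoly K N).subtype).codRestrict _ fun f => by
        obtain ⟨d, hd⟩ := f.2
        exact ⟨d, fun i => (totalDegree_translation_le _ _).trans (hd i)⟩

theorem translationFamily_apply (u : ∀ i, Fin (N i) → K i) (f : boundedPoly K N) (i : ℕ) :
    (translationFamily u f).1 i = translation (u i) (f.1 i) := rfl

theorem exists_translation (h : IsBoundedUltraproduct U κ π) (u : ∀ i, Fin (N i) → K i) :
    ∃ τ : S →ₐ[F] S, ∀ f, τ (π f) = π (translationFamily u f) := by
  obtain ⟨τ, hτ⟩ : ∃ τ : S →+* S, ∀ f, τ (π f) = π (translationFamily u f) := by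
    refine ⟨RingHom.liftOfSurjective π h.surjective ⟨π.comp (translationFamily u), fun f hf => ?_⟩,
      fun f => RingHom.liftOfRightInverse_comp_apply _ _ _ _ _⟩
    rw [RingHom.mem_ker, h.eq_zero_iff] at hf
    rw [RingHom.mem_ker, RingHom.comp_apply, h.eq_zero_iff]
    filter_upwards [hf] with i hi
    rw [translationFamily_apply, hi, map_zero]
  refine ⟨⟨τ, fun a => ?_⟩, hτ⟩
  obtain ⟨c, rfl⟩ := h.surjective_scalar a
  rw [h.algebraMap_eq]
  refine (hτ _).trans ?_
  congr 1
  refine Subtype.ext (funext fun i => ?_)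
  change translation (u i) (C (c i)) = C (c i)
  rw [algHom_C, MvPolynomial.algebraMap_eq]

/-- The bounded ultraproduct of polynomial rings is a polynomial ring. -/
theorem exists_bijective_aeval [∀ i, IsAlgClosed (K i)] (h : IsBoundedUltraproduct U κ π) :
    ∃ (Y : Type u) (e : Y → ℕ) (y : Y → boundedPoly K N), (∀ j, 0 < e j) ∧
      (∀ j i, ((y j).1 i).IsHomogeneous (e j)) ∧
      Function.Bijective (aeval (R := F) fun j => π (y j)) := by
  have := h.nontrivial
  have := h.isReduced
  choose τ hτ using h.exists_translation
  have hroot : ∀ p : ℕ, p ≠ 0 → ∀ a : F, ∃ b, b ^ p = a := by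
    intro p hp a
    obtain ⟨c, rfl⟩ := h.surjective_scalar a
    choose b hb using fun i => IsAlgClosed.exists_pow_nat_eq (c i) (Nat.pos_of_ne_zero hp)
    exact ⟨κ b, by rw [← map_pow]; congr 1; exact funext hb⟩
  have htrans : ∀ u i f, f ∈ h.grading i → ∃ a : ℕ → S, (∀ l, a l ∈ h.grading l) ∧
      τ u f = f + ∑ l ∈ Finset.range i, a l := by
    rintro u n _ ⟨f, hf, rfl⟩
    refine ⟨fun l => π (component (translationFamily u f) l), h.component_mem _, ?_⟩
    rw [hτ, ← map_sum, ← map_add]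
    congr 1
    refine Subtype.ext (funext fun i => ?_)
    rw [Subring.coe_add, Pi.add_apply, AddSubmonoidClass.coe_finsetSum, Finset.sum_apply]
    exact translation_eq_add_sum (hf i)
  have hinv : ∀ f, (∀ u, τ u f = f) → ∃ c, algebraMap F S c = f := by
    intro s hs
    obtain ⟨f, rfl⟩ := h.surjective s
    have hu : ∀ i, ∃ u, translation u (f.1 i) = f.1 i → ∀ v, translation v (f.1 i) = f.1 i := by
      intro i
      by_cases hv : ∀ v, translation v (f.1 i) = f.1 i
      · exact ⟨0, fun _ => hv⟩
      · push Not at hv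
        obtain ⟨v, hv⟩ := hv
        exact ⟨v, fun h => absurd h hv⟩
    choose u hu using hu
    have h1 := hs u
    rw [hτ, h.eq_iff] at h1
    refine ⟨κ fun i => eval 0 (f.1 i), ?_⟩
    rw [h.algebraMap_eq, h.eq_iff]
    filter_upwards [h1] with i hi
    have := IsAlgClosed.instInfinite (K := K i)
    exact (eq_C_of_translation_eq (hu i hi)).symm
  obtain ⟨Y, e, y, he, hy, hbij⟩ := h.isConnectedGrading.exists_bijective_aeval hroot τ htrans hinv
  choose g hg hgy using hy
  obtain rfl : (fun j => π (g j)) = y := funext hgy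
  exact ⟨Y, e, g, he, hg, hbij⟩

end IsBoundedUltraproduct

end

section

open MvPolynomial Filter

namespace IsBoundedUltraproduct

theorem exists_model (U : Ultrafilter ℕ) (K : ℕ → Type u) [∀ i, Field (K i)] (N : ℕ → ℕ) :
    ∃ (F S : Type u) (_ : Field F) (_ : CommRing S) (_ : Algebra F S) (κ : (∀ i, K i) →+* F)
      (π : boundedPoly K N →+* S), IsBoundedUltraproduct U κ π := by
  let I : Ideal (∀ i, K i) :=
    { carrier := {c | ∀ᶠ i in U, c i = 0}
      add_mem' := fun {a b} ha hb => by
        filter_upwards [ha, hb] with i hi hj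
        rw [Pi.add_apply, hi, hj, add_zero]
      zero_mem' := Eventually.of_forall fun _ => rfl
      smul_mem' := fun c a ha => by
        filter_upwards [ha] with i hi
        rw [smul_eq_mul, Pi.mul_apply, hi, mul_zero] }
  let J : Ideal (boundedPoly K N) :=
    { carrier := {f | ∀ᶠ i in U, f.1 i = 0}
      add_mem' := fun {a b} ha hb => by
        filter_upwards [ha, hb] with i hi hj
        rw [Subring.coe_add, Pi.add_apply, hi, hj, add_zero]
      zero_mem' := Eventually.of_forall fun _ => rfl
      smul_mem' := fun c a ha => by
        filter_upwards [ha] with i hi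
        rw [smul_eq_mul, Subring.coe_mul, Pi.mul_apply, hi, mul_zero] }
  have hI : I.IsMaximal := by
    classical
    refine Ideal.isMaximal_iff.mpr ⟨fun h1 => ?_, fun L x hIL hx hxL => ?_⟩
    · obtain ⟨i, hi⟩ := Eventually.exists (f := (U : Filter ℕ)) h1
      exact one_ne_zero hi
    · have hx' : ∀ᶠ i in U, x i ≠ 0 := Ultrafilter.eventually_not.mpr hx
      have h1 : 1 - x⁻¹ * x ∈ L := hIL (by
        filter_upwards [hx'] with i hi
        simp [hi])
      have h2 := L.add_mem h1 (L.mul_mem_left x⁻¹ hxL)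
      rwa [sub_add_cancel] at h2
  let _ : Field ((∀ i, K i) ⧸ I) := Ideal.Quotient.field I
  let φ : ((∀ i, K i) ⧸ I) →+* (boundedPoly K N ⧸ J) :=
    Ideal.Quotient.lift I ((Ideal.Quotient.mk J).comp (boundedPoly.const K N)) fun c hc => by
      refine Ideal.Quotient.eq_zero_iff_mem.mpr ?_
      filter_upwards [hc] with i hi
      change C (c i) = 0
      rw [hi, C_0]
  let _ : Algebra ((∀ i, K i) ⧸ I) (boundedPoly K N ⧸ J) := φ.toAlgebra
  exact ⟨_, _, inferInstance, inferInstance, inferInstance, Ideal.Quotient.mk I,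
    Ideal.Quotient.mk J,
    Ideal.Quotient.mk_surjective, Ideal.Quotient.mk_surjective,
    fun f => Ideal.Quotient.eq_zero_iff_mem, fun c => rfl⟩

variable {U : Ultrafilter ℕ} {K : ℕ → Type u} [∀ i, Field (K i)]
  {N : ℕ → ℕ} {F S : Type u} [Field F] [CommRing S] [Algebra F S] {κ : (∀ i, K i) →+* F}
  {π : boundedPoly K N →+* S}

/-- Polynomials over an ultraproduct are represented by families of polynomials. -/
theorem exists_lift {k : ℕ} (h : IsBoundedUltraproduct U κ π) (g : Fin k → boundedPoly K N)
    (Q : MvPolynomial (Fin k) F) :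
    ∃ P : ∀ i, MvPolynomial (Fin k) (K i), (∃ D, ∀ i, (P i).totalDegree ≤ D) ∧
      ∀ f : boundedPoly K N, π f = aeval (fun l => π (g l)) Q →
        ∀ᶠ i in U, f.1 i = aeval (fun l => (g l).1 i) (P i) := by
  obtain ⟨P, rfl⟩ := map_surjective κ h.surjective_scalar Q
  refine ⟨fun i => map (Pi.evalRingHom K i) P,
    ⟨P.totalDegree, fun i => Finset.sup_mono (support_map_subset _ _)⟩,
    fun f hf => ?_⟩
  have h1 : aeval (fun l => π (g l)) (map κ P) = π (eval₂ (boundedPoly.const K N) g P) := by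
    have hcomp : (algebraMap F S).comp κ = π.comp (boundedPoly.const K N) :=
      RingHom.ext h.algebraMap_eq
    rw [aeval_def, eval₂_map, hcomp, eval₂_comp_left]
    rfl
  rw [h1, h.eq_iff] at hf
  filter_upwards [hf] with i hi
  rw [hi, aeval_def, eval₂_map]
  exact eval₂_comp_left ((Pi.evalRingHom (fun i => MvPolynomial (Fin (N i)) (K i)) i).comp
    (boundedPoly K N).subtype) _ _ _

theorem eventually_regular {k : ℕ} (h : IsBoundedUltraproduct U κ π) {g : Fin k → boundedPoly K N}
    {e : Fin k → ℕ} (hg : ∀ l i, ((g l).1 i).IsHomogeneous (e l))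
    (hreg : ∀ j s, π (g j) * s ∈ Ideal.span ((fun l => π (g l)) '' {l | l < j}) →
      s ∈ Ideal.span ((fun l => π (g l)) '' {l | l < j})) (E : ℕ) :
    ∀ᶠ i in U, ∀ j, ∀ n ≤ E, ∀ f : MvPolynomial (Fin (N i)) (K i), f.IsHomogeneous n →
      (g j).1 i * f ∈ Ideal.span ((fun l => (g l).1 i) '' {l | l < j}) →
        f ∈ Ideal.span ((fun l => (g l).1 i) '' {l | l < j}) := by
  classical
  rw [eventually_all]
  intro j
  refine (eventually_all_finite (Set.finite_le_nat E)).mpr fun n _ => ?_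
  by_contra hcon
  rw [← Ultrafilter.eventually_not] at hcon
  have hJ : {l : Fin k | l < j} =
      ((Finset.univ.filter (· < j) : Finset (Fin k)) : Set (Fin k)) := by
    ext; simp
  rw [hJ] at hcon
  have hreg' := hreg j
  rw [hJ] at hreg'
  set J : Finset (Fin k) := Finset.univ.filter (· < j)
  have hex : ∀ i, ∃ (f : MvPolynomial (Fin (N i)) (K i))
      (a : Fin k → MvPolynomial (Fin (N i)) (K i)), f.IsHomogeneous n ∧
      (∀ l, (a l).totalDegree ≤ e j + n) ∧
      (¬ (∀ f : MvPolynomial (Fin (N i)) (K i), f.IsHomogeneous n →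
        (g j).1 i * f ∈ Ideal.span ((fun l => (g l).1 i) '' J) →
          f ∈ Ideal.span ((fun l => (g l).1 i) '' J)) →
      (g j).1 i * f = ∑ l ∈ J, a l * (g l).1 i ∧
        f ∉ Ideal.span ((fun l => (g l).1 i) '' J)) := by
    intro i
    by_cases hi : ∀ f : MvPolynomial (Fin (N i)) (K i), f.IsHomogeneous n →
        (g j).1 i * f ∈ Ideal.span ((fun l => (g l).1 i) '' J) →
          f ∈ Ideal.span ((fun l => (g l).1 i) '' J)
    · exact ⟨0, 0, isHomogeneous_zero _ _ _, fun l => by simp, fun h => absurd hi h⟩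
    · have hi' := hi
      push Not at hi'
      obtain ⟨f, hf, hgf, hfJ⟩ := hi'
      obtain ⟨a, had, ha⟩ := ((hg j i).mul hf).exists_eq_sum_of_mem_span (fun l => hg l i) hgf
      exact ⟨f, a, hf, had, fun _ => ⟨ha, hfJ⟩⟩
  choose f a hf had hfa using hex
  let f' : boundedPoly K N := ⟨f, n, fun i => (hf i).totalDegree_le⟩
  let a' : Fin k → boundedPoly K N := fun l => ⟨fun i => a i l, e j + n, fun i => had i l⟩
  have h1 : π (g j) * π f' = ∑ l ∈ J, π (a' l) * π (g l) := by
    simp_rw [← map_mul]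
    rw [← map_sum, h.eq_iff]
    filter_upwards [hcon] with i hi
    rw [AddSubmonoidClass.coe_finsetSum, Finset.sum_apply]
    exact (hfa i hi).1
  have h2 := hreg' (π f') (by
    rw [h1]
    exact Ideal.sum_mem _ fun l hl => Ideal.mul_mem_left _ _ (Ideal.subset_span ⟨l, hl, rfl⟩))
  obtain ⟨b, hb⟩ := (Submodule.mem_span_image_finset_iff_exists_fun' _).mp h2
  choose b' hb' using fun l => h.surjective (b l)
  simp_rw [← hb', smul_eq_mul, ← map_mul] at hb
  rw [← map_sum, h.eq_iff] at hb
  obtain ⟨i, hi, hi'⟩ := (hcon.and hb).exists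
  refine (hfa i hi).2 ?_
  rw [AddSubmonoidClass.coe_finsetSum, Finset.sum_apply] at hi'
  change _ = f i at hi'
  rw [← hi']
  exact Ideal.sum_mem _ fun l hl => Ideal.mul_mem_left _ _ (Ideal.subset_span ⟨l, hl, rfl⟩)

theorem exists_eventually_kerBound [∀ i, IsAlgClosed (K i)] (h : IsBoundedUltraproduct U κ π)
    {p q d : ℕ} (A : ∀ i, Fin q → Fin p → MvPolynomial (Fin (N i)) (K i))
    (hA : ∀ i a j, (A i a j).totalDegree ≤ d) : ∃ B, ∀ᶠ i in U, KerBound (A i) B := by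
  classical
  obtain ⟨Y, e, y, he, hy, hbij⟩ := h.exists_bijective_aeval
  let c : Fin q → Fin p → boundedPoly K N := fun a j => ⟨fun i => A i a j, d, fun i => hA i a j⟩
  choose P hP using fun a j => hbij.2 (π (c a j))
  let s : Finset Y := Finset.univ.biUnion fun a => Finset.univ.biUnion fun j => (P a j).vars
  let v : Fin s.card → Y := fun l => s.equivFin.symm l
  have hv : Function.Injective v := Subtype.val_injective.comp s.equivFin.symm.injective
  have hvs : ∀ x ∈ s, x ∈ Set.range v := fun x hx => ⟨s.equivFin ⟨x, hx⟩, by simp [v]⟩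
  have hQ : ∀ a j, ∃ Q, rename v Q = P a j := fun a j =>
    exists_rename_eq_of_vars_subset_range (P a j) v hv fun x hx => hvs x (by
      simp only [s, Finset.mem_biUnion, Finset.mem_univ, true_and]
      exact ⟨a, j, hx⟩)
  choose Q hQ using hQ
  have hcQ : ∀ a j, π (c a j) = aeval (fun l => π (y (v l))) (Q a j) := fun a j => by
    rw [← hP, ← hQ, aeval_rename]
    rfl
  choose P' hP' hcP' using fun a j => h.exists_lift (fun l => y (v l)) (Q a j)
  choose D hD using hP'
  let D' := ∑ a, ∑ j, D a j
  have hDD' : ∀ a j, D a j ≤ D' := fun a j =>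
    (Finset.single_le_sum (f := fun j => D a j) (fun _ _ => Nat.zero_le _) (Finset.mem_univ j)).trans
      (Finset.single_le_sum (f := fun a => ∑ j, D a j) (fun _ _ => Nat.zero_le _)
        (Finset.mem_univ a))
  obtain ⟨E, hE⟩ := exists_flat_aeval_of_regular_le.{u, 0} (fun l => e (v l)) fun l => he _
  obtain ⟨B, hB⟩ := exists_kerBound_of_infinite.{u} s.card p q D'
  let e' := ∑ l, e (v l)
  refine ⟨B * (e' + 1), ?_⟩
  have hreg := h.eventually_regular (g := fun l => y (v l)) (fun l i => hy (v l) i)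
    (fun j x hx => by
    let φ := RingEquiv.ofBijective _ hbij
    have hφ : ∀ l, φ (X l) = π (y l) := fun l => aeval_X _ _
    have himage : Ideal.span ((fun l => π (y (v l))) '' {l | l < j}) =
        Ideal.map φ (Ideal.span (X '' (v '' {l | l < j}))) := by
      rw [Ideal.map_span, Set.image_image, Set.image_image]
      simp_rw [hφ]
    obtain ⟨x, rfl⟩ := φ.surjective x
    rw [himage] at hx ⊢
    rw [← hφ, ← map_mul, Ideal.mem_map_of_equiv] at hx
    obtain ⟨x', hx', hxx⟩ := hx
    rw [φ.injective hxx] at hx'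
    refine Ideal.mem_map_of_mem _ (X_mul_mem_span_image_X ?_ hx')
    rintro ⟨l, hl, hlj⟩
    exact (hv hlj).not_lt hl) E
  have hAP : ∀ᶠ i in U, ∀ a j, A i a j = aeval (fun l => (y (v l)).1 i) (P' a j i) := by
    rw [eventually_all]
    intro a
    rw [eventually_all]
    intro j
    exact hcP' a j (c a j) (hcQ a j)
  filter_upwards [hreg, hAP] with i hi hAi
  have := IsAlgClosed.instInfinite (K := K i)
  have hflat := hE (K i) (Fin (N i)) (fun l => (y (v l)).1 i) (fun l => hy _ _) hi
  have hk := (hB (K i) (fun a j => P' a j i) fun a j => (hD a j i).trans (hDD' a j)).aeval_of_flat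
    hflat (e := e') fun l => ((hy _ _).totalDegree_le).trans
      (Finset.single_le_sum (f := fun l => e (v l)) (fun _ _ => Nat.zero_le _) (Finset.mem_univ l))
  convert! hk using 3
  exact hAi _ _

end IsBoundedUltraproduct

theorem exists_kerBound (p q d : ℕ) : ∃ B : ℕ, ∀ (K : Type u) [Field K] [IsAlgClosed K] (N : ℕ)
    (A : Fin q → Fin p → MvPolynomial (Fin N) K), (∀ a j, (A a j).totalDegree ≤ d) →
      KerBound A B := by
  by_contra! hcon
  choose K _ _ N A hA hbad using hcon
  obtain ⟨F, S, _, _, _, κ, π, h⟩ := IsBoundedUltraproduct.exists_model (hyperfilter ℕ) K N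
  obtain ⟨B, hB⟩ := h.exists_eventually_kerBound A hA
  have hge : ∀ᶠ i in (hyperfilter ℕ : Filter ℕ), B ≤ i :=
    (eventually_ge_atTop B).filter_mono Nat.hyperfilter_le_atTop
  obtain ⟨i, hi, hBi⟩ := (hB.and hge).exists
  exact hbad i (hi.mono hBi)

end

section

open MvPolynomial

/-- The linear system describing the intersection of the submodules generated by the `g l`. -/
def intersectionSystem {R ι α β : Type*} [CommRing R] [DecidableEq ι] (g : ι → α → β → R) (l₀ : ι)
    (k : ι × β) (i : ι × α) : R :=
  (if i.1 = l₀ then g l₀ i.2 k.2 else 0) - (if i.1 = k.1 then g k.1 i.2 k.2 else 0)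

theorem intersectionSystem_sum {R ι α β : Type*} [CommRing R] [Fintype ι] [DecidableEq ι]
    [Fintype α] (g : ι → α → β → R) (l₀ : ι) (s : ι × α → R) (l : ι) (j : β) :
    ∑ i, intersectionSystem g l₀ (l, j) i * s i =
      ∑ a, s (l₀, a) * g l₀ a j - ∑ a, s (l, a) * g l a j := by
  have key : ∀ l, ∑ i : ι × α, (if i.1 = l then g l i.2 j else 0) * s i =
      ∑ a, s (l, a) * g l a j := fun l => by
    rw [Fintype.sum_prod_type, Finset.sum_eq_single l]
    · simp [mul_comm]
    · intro l' _ hl'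
      simp [hl']
    · simp
  simp_rw [intersectionSystem, sub_mul, Finset.sum_sub_distrib, key]

/-- Generators of an intersection of submodules obtained from solutions of a linear system. -/
theorem exists_generators_iInf {K σ ι α β : Type*} [CommRing K] [Fintype ι] [DecidableEq ι]
    [Fintype α] {d B : ℕ} (g : ι → α → β → MvPolynomial σ K)
    (hg : ∀ l a j, (g l a j).totalDegree ≤ d) (l₀ : ι)
    (h : KerBound (intersectionSystem g l₀) B) :
    ∃ v : Fin (B + d) → β → MvPolynomial σ K, (∀ b j, (v b j).totalDegree ≤ B + d) ∧
      Submodule.span (MvPolynomial σ K) (Set.range v) =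
        ⨅ l, Submodule.span (MvPolynomial σ K) (Set.range (g l)) := by
  obtain ⟨s, h1, h2, h3⟩ := h
  let v : Fin B → β → MvPolynomial σ K := fun b => ∑ a, s b (l₀, a) • g l₀ a
  have hv : ∀ b l, v b = ∑ a, s b (l, a) • g l a := fun b l => funext fun j => by
    have := h2 b (l, j)
    rw [intersectionSystem_sum, sub_eq_zero] at this
    simpa [v] using this
  have hspan : Submodule.span (MvPolynomial σ K) (Set.range v) =
      ⨅ l, Submodule.span (MvPolynomial σ K) (Set.range (g l)) := by
    refine le_antisymm (Submodule.span_le.mpr ?_) fun x hx => ?_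
    · rintro _ ⟨b, rfl⟩
      refine (Submodule.mem_iInf _).mpr fun l => ?_
      rw [hv b l]
      exact Submodule.sum_mem _ fun a _ => Submodule.smul_mem _ _ (Submodule.subset_span ⟨a, rfl⟩)
    · rw [Submodule.mem_iInf] at hx
      choose t ht using fun l => (Submodule.mem_span_range_iff_exists_fun _).mp (hx l)
      obtain ⟨c, hc⟩ := h3 (fun i => t i.1 i.2) fun k => by
        rw [intersectionSystem_sum, sub_eq_zero]
        have := congrFun ((ht l₀).trans (ht k.1).symm) k.2
        simpa using this
      refine (Submodule.mem_span_range_iff_exists_fun _).mpr ⟨c, ?_⟩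
      rw [← ht l₀]
      simp_rw [v, Finset.smul_sum, smul_smul]
      rw [Finset.sum_comm]
      refine Finset.sum_congr rfl fun a _ => ?_
      rw [← Finset.sum_smul, ← hc (l₀, a)]
  refine ⟨Fin.append v 0, fun b => ?_, ?_⟩
  · refine Fin.addCases (fun b j => ?_) (fun b j => ?_) b
    · simp only [Fin.append_left, v, Finset.sum_apply]
      refine totalDegree_finsetSum_le fun a _ => ?_
      exact (totalDegree_mul _ _).trans (add_le_add (h1 _ _) (hg _ _ _))
    · simp
  · rw [← hspan]
    refine le_antisymm (Submodule.span_le.mpr ?_) (Submodule.span_mono ?_)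
    · rintro _ ⟨b, rfl⟩
      refine Fin.addCases (fun b => ?_) (fun b => ?_) b
      · rw [Fin.append_left]
        exact Submodule.subset_span ⟨b, rfl⟩
      · rw [Fin.append_right]
        exact Submodule.zero_mem _
    · rintro _ ⟨b, rfl⟩
      exact ⟨Fin.castAdd d b, Fin.append_left _ _ _⟩

end

/-- For every `h ≥ 2` there is a function `Λ`, independent of `N` and `K`,
such that for every algebraically closed field `K` and all submodules `M_1, …, M_h` of `R^m`
(`R = K[x_1, …, x_N]`), each generated by at most `n` elements of degree at most `d`, the
intersection `M_1 ∩ ⋯ ∩ M_h` is generated by at most `Λ m n d h` elements of degree at most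
`Λ m n d h`. -/
theorem statement12 :
    ∃ Λ : ℕ → ℕ → ℕ → ℕ → ℕ,
      ∀ h : ℕ, 2 ≤ h →
      ∀ (K : Type u) [Field K] [IsAlgClosed K] (N m n d : ℕ)
        (M : Fin h → Submodule (MvPolynomial (Fin N) K) (Fin m → MvPolynomial (Fin N) K)),
        (∀ l, ∃ g : Fin n → (Fin m → MvPolynomial (Fin N) K),
          (∀ a j, (g a j).totalDegree ≤ d) ∧
          Submodule.span (MvPolynomial (Fin N) K) (Set.range g) = M l) →
        ∃ g : Fin (Λ m n d h) → (Fin m → MvPolynomial (Fin N) K),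
          (∀ a j, (g a j).totalDegree ≤ Λ m n d h) ∧
          Submodule.span (MvPolynomial (Fin N) K) (Set.range g) = ⨅ l, M l := by
  classical
  choose B hB using fun m n d h : ℕ => exists_kerBound.{u} (h * n) (h * m) d
  refine ⟨fun m n d h => B m n d h + d, fun h hh K _ _ N m n d M hM => ?_⟩
  choose g hg hM using hM
  let l₀ : Fin h := ⟨0, by omega⟩
  have hker : KerBound (intersectionSystem g l₀) (B m n d h) :=
    KerBound.reindex finProdFinEquiv.symm finProdFinEquiv.symm (hB m n d h K N _ fun k i => by
      refine (MvPolynomial.totalDegree_sub _ _).trans (max_le ?_ ?_)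
      · split_ifs
        exacts [hg _ _ _, by simp]
      · split_ifs
        exacts [hg _ _ _, by simp])
  obtain ⟨v, hv, hspan⟩ := exists_generators_iInf g hg l₀ hker
  exact ⟨v, hv, by simp_rw [hspan, hM]⟩
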